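/- arXiv:2207.07213 — 7 statements merged into one kernel-verified Lean document; each statement's English description precedes it below -/
import Mathlib

section
/- Let ℓ be a prime and let α_1,…,α_t ∈ ℤ be integers at least one of which is coprime to ℓ. Let b_1,…,b_m be the distinct nonzero values among |α_1|,…,|α_t|, and for j = 1,…,m set t_j := #{i : |α_i| = b_j}. Then the polynomial Σ_{i=1}^t P_{α_i}(X) lies in ℓℤ[X] (every coefficient is divisible by ℓ) if and only if ℓ divides t_j for every j = 1,…,m. -/
/-- The shifted Chebyshev polynomial `P_a(X) = 2 - 2·T_a(1 - X/2)`, where `T_a` is the `a`-th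
Chebyshev polynomial of the first kind.  It has integer coefficients; we work over `ℚ` so
that the substitution `X ↦ 1 - X/2` makes sense. -/
noncomputable def shiftedChebyshev (a : ℕ) : Polynomial ℚ :=
  2 - 2 * (Polynomial.Chebyshev.T ℚ (a : ℤ)).comp (1 - Polynomial.C (2⁻¹ : ℚ) * Polynomial.X)

/-- The shifted Chebyshev polynomial of an arbitrary integer, `P_a := P_{|a|}`. -/
noncomputable def shiftedChebyshevInt (a : ℤ) : Polynomial ℚ :=
  shiftedChebyshev a.natAbs

open Polynomial in
theorem Polynomial.Chebyshev.degree_C_natCast_add_one (R : Type*) [CommRing R] [Nontrivial R] :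
    ∀ n : ℕ, (Chebyshev.C R (n + 1 : ℕ)).degree = ((n + 1 : ℕ) : WithBot ℕ)
  | 0 => by simp
  | 1 => by
    rw [show ((1 + 1 : ℕ) : ℤ) = 2 by norm_num, Chebyshev.C_two]
    exact degree_X_pow_sub_C (n := 2) (by norm_num) (2 : R)
  | n + 2 => by
    have h₁ := degree_C_natCast_add_one R (n + 1)
    have h₀ := degree_C_natCast_add_one R n
    have hX : (X * Chebyshev.C R (n + 1 + 1 : ℕ)).degree = ((n + 2 + 1 : ℕ) : WithBot ℕ) := by
      rw [mul_comm, degree_mul_X, h₁]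
      norm_cast
    have hrec := Chebyshev.C_add_two R ((n + 1 : ℕ) : ℤ)
    rw [show ((n + 1 : ℕ) : ℤ) + 2 = ((n + 2 + 1 : ℕ) : ℤ) by push_cast; ring,
      show ((n + 1 : ℕ) : ℤ) + 1 = ((n + 1 + 1 : ℕ) : ℤ) by push_cast; ring] at hrec
    rw [hrec, degree_sub_eq_left_of_degree_lt, hX]
    rw [hX, h₀]
    exact_mod_cast (by lia : n + 1 < n + 2 + 1)

open Polynomial in
/-- The shifted Chebyshev polynomial over an arbitrary commutative ring, written through the
rescaled Chebyshev polynomial `C_a(X) = 2·T_a(X/2)`. -/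
noncomputable def shiftedChebyshevOver (R : Type*) [CommRing R] (a : ℕ) : R[X] :=
  2 - (Chebyshev.C R a).comp (2 - X)

namespace shiftedChebyshevOver

open Polynomial

theorem map_eq {R S : Type*} [CommRing R] [CommRing S] (f : R →+* S) (a : ℕ) :
    (shiftedChebyshevOver R a).map f = shiftedChebyshevOver S a := by
  simp [shiftedChebyshevOver, Polynomial.map_comp]

theorem rat_eq (a : ℕ) : shiftedChebyshevOver ℚ a = shiftedChebyshev a := by
  have h : (2 * X : ℚ[X]).comp (1 - C (2⁻¹ : ℚ) * X) = 2 - X := by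
    have h2 : (2 : ℚ[X]) = C 2 := rfl
    simp only [h2, mul_comp, C_comp, X_comp, mul_sub, mul_one, ← mul_assoc, ← C_mul]
    norm_num
  have h' := congrArg (fun p : ℚ[X] => p.comp (1 - C (2⁻¹ : ℚ) * X))
    (Chebyshev.C_comp_two_mul_X ℚ (a : ℤ))
  simp only [comp_assoc, h] at h'
  rw [shiftedChebyshevOver, shiftedChebyshev, h', mul_comp, ofNat_comp]
  rfl

@[simp]
theorem zero (R : Type*) [CommRing R] : shiftedChebyshevOver R 0 = 0 := by
  simp [shiftedChebyshevOver]

theorem degree_eq {R : Type*} [CommRing R] [IsDomain R] {a : ℕ} (ha : a ≠ 0) :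
    (shiftedChebyshevOver R a).degree = a := by
  obtain ⟨n, rfl⟩ := Nat.exists_eq_succ_of_ne_zero ha
  have hlin : (2 - X : R[X]).natDegree = 1 := by
    rw [← neg_sub, natDegree_neg]
    exact natDegree_X_sub_C (2 : R)
  have hC := natDegree_eq_of_degree_eq_some (Chebyshev.degree_C_natCast_add_one R n)
  have hcomp : ((Chebyshev.C R (n + 1 : ℕ)).comp (2 - X)).natDegree = n + 1 := by
    rw [natDegree_comp, hC, hlin, mul_one]
  have hdeg : ((Chebyshev.C R (n + 1 : ℕ)).comp (2 - X)).degree = ((n + 1 : ℕ) : WithBot ℕ) :=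
    (degree_eq_iff_natDegree_eq_of_pos n.succ_pos).2 hcomp
  rw [shiftedChebyshevOver, degree_sub_eq_right_of_degree_lt, hdeg]
  rw [hdeg]
  exact degree_C_le (a := (2 : R)).trans_lt (by exact_mod_cast n.succ_pos)

theorem sum_smul_eq_zero_iff {R : Type*} [CommRing R] [IsDomain R] (s : Finset ℕ) (c : ℕ → R) :
    ∑ b ∈ s, c b • shiftedChebyshevOver R b = 0 ↔ ∀ b ∈ s, b ≠ 0 → c b = 0 := by
  constructor
  · let S : Polynomial.Sequence R :=
      { elems' := fun b => if b = 0 then 1 else shiftedChebyshevOver R b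
        degree_eq' := fun b => by
          split_ifs with hb
          · simp [hb]
          · exact degree_eq hb }
    intro h b hb hb0
    refine linearIndependent_iff'.1 S.linearIndependent (s.erase 0) c ?_ b
      (Finset.mem_erase.2 ⟨hb0, hb⟩)
    rw [← h, ← Finset.sum_erase s (a := 0) (by simp)]
    refine Finset.sum_congr rfl fun i hi => ?_
    rw [show S i = shiftedChebyshevOver R i from if_neg (Finset.ne_of_mem_erase hi)]
  · intro h
    refine Finset.sum_eq_zero fun b hb => ?_
    by_cases hb0 : b = 0
    · simp [hb0]
    · simp [h b hb hb0]

end shiftedChebyshevOver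

open Polynomial in
theorem Polynomial.map_intCast_zmod_eq_zero_iff (n : ℕ) (p : ℤ[X]) :
    p.map (Int.castRingHom (ZMod n)) = 0 ↔
      ∀ k, ∃ c : ℤ, (p.map (Int.castRingHom ℚ)).coeff k = (n : ℚ) * (c : ℚ) := by
  rw [Polynomial.ext_iff]
  refine forall_congr' fun k => ?_
  simp only [coeff_map, coeff_zero, eq_intCast, ZMod.intCast_zmod_eq_zero_iff_dvd, Dvd.dvd]
  exact exists_congr fun c => by norm_cast

/-- for integers `α_1, …, α_t`, at least one coprime to the prime `ℓ`, the sum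
`Σ_i P_{α_i}(X)` lies in `ℓℤ[X]` (every coefficient is `ℓ` times an integer) if and only if
for every nonzero value `b` among `|α_1|, …, |α_t|` the number of indices `i` with
`|α_i| = b` is divisible by `ℓ`. -/
theorem sum_shiftedChebyshev_in_ellZX_iff
    (ℓ : ℕ) (hp : ℓ.Prime) (t : ℕ) (α : Fin t → ℤ)
    (hadm : ∃ i, ¬ (ℓ : ℤ) ∣ α i) :
    (∀ k : ℕ, ∃ c : ℤ, (∑ i, shiftedChebyshevInt (α i)).coeff k = (ℓ : ℚ) * (c : ℚ)) ↔
      (∀ b : ℕ, b ≠ 0 → (∃ i, (α i).natAbs = b) →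
        ℓ ∣ (Finset.univ.filter fun i => (α i).natAbs = b).card) := by
  have := Fact.mk hp
  have hrat : ∑ i, shiftedChebyshevInt (α i) =
      (∑ i, shiftedChebyshevOver ℤ (α i).natAbs).map (Int.castRingHom ℚ) := by
    simp [Polynomial.map_sum, shiftedChebyshevOver.map_eq, shiftedChebyshevOver.rat_eq,
      shiftedChebyshevInt]
  have hmod : (∑ i, shiftedChebyshevOver ℤ (α i).natAbs).map (Int.castRingHom (ZMod ℓ)) =
      ∑ b ∈ Finset.univ.image fun i => (α i).natAbs,
        ((Finset.univ.filter fun i => (α i).natAbs = b).card : ZMod ℓ) •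
          shiftedChebyshevOver (ZMod ℓ) b := by
    simp only [Polynomial.map_sum, shiftedChebyshevOver.map_eq, Nat.cast_smul_eq_nsmul]
    exact Finset.sum_comp (shiftedChebyshevOver (ZMod ℓ)) fun i => (α i).natAbs
  rw [hrat, ← Polynomial.map_intCast_zmod_eq_zero_iff, hmod,
    shiftedChebyshevOver.sum_smul_eq_zero_iff]
  simp only [Finset.mem_image, Finset.mem_univ, true_and, ZMod.natCast_eq_zero_iff]
  exact forall_congr' fun b => imp.swap
end

section
/- Let ℓ be an odd prime and t ≥ 2 an integer, and let τ be the Haar probability measure on ℤ_ℓ^t. Then τ({α ∈ ℤ_ℓ^t \ (ℓℤ_ℓ)^t : α_1² + ⋯ + α_t² ∈ ℤ_ℓ^×}) / (1 − ℓ^{−t}) equals 1 − (ℓ^{t−1} + (−1)^{t(ℓ−1)/4}·(ℓ−1)·ℓ^{t/2−1} − 1)/(ℓ^t − 1) if t is even, and equals 1 − (ℓ^{t−1} − 1)/(ℓ^t − 1) if t is odd. (Since β_2 = −Σ_k α_k², the event α_1²+⋯+α_t² ∈ ℤ_ℓ^× is exactly that the ℤ_ℓ-tower of the bouquet X_t attached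 to α has μ = 0 and λ = 1; so the left side is Prob_ℓ(X_t; μ=0, λ=1).) -/
open PowerSeries

/-- The binomial coefficient `C(a,n) = a(a-1)⋯(a-n+1)/n!` of an `ℓ`-adic integer `a`,
as an `ℓ`-adic integer.  (The norm condition in the `if` is always satisfied.) -/
noncomputable def padicChoose {ℓ : ℕ} [Fact ℓ.Prime] (a : ℤ_[ℓ]) (n : ℕ) : ℤ_[ℓ] :=
  if h : ‖(∏ i ∈ Finset.range n, ((a : ℚ_[ℓ]) - (i : ℚ_[ℓ]))) / (n.factorial : ℚ_[ℓ])‖ ≤ 1 then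
    ⟨_, h⟩
  else 0

/-- The binomial power series `(1+T)^a = Σ_{n≥0} C(a,n) Tⁿ ∈ ℤ_ℓ⟦T⟧` for `a ∈ ℤ_ℓ`. -/
noncomputable def onePlusTPow {ℓ : ℕ} [Fact ℓ.Prime] (a : ℤ_[ℓ]) : PowerSeries ℤ_[ℓ] :=
  PowerSeries.mk fun n => padicChoose a n

/-- The characteristic power series `f_α(T) = Σ_{k=1}^t (2 - (1+T)^{α_k} - (1+T)^{-α_k})`
of the bouquet `X_t` with `t` loops and voltage vector `α ∈ ℤ_ℓ^t`. -/
noncomputable def bouquetSeries {ℓ : ℕ} [Fact ℓ.Prime] {t : ℕ} (α : Fin t → ℤ_[ℓ]) :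
    PowerSeries ℤ_[ℓ] :=
  ∑ k, (2 - onePlusTPow (α k) - onePlusTPow (-(α k)))
noncomputable instance {ℓ : ℕ} [Fact ℓ.Prime] : MeasurableSpace ℤ_[ℓ] := borel _
instance {ℓ : ℕ} [Fact ℓ.Prime] : BorelSpace ℤ_[ℓ] := ⟨rfl⟩

/-- The fibres of a surjective homomorphism onto a finite group all have the same mass under a
left-invariant probability measure. -/
theorem measureReal_preimage_finset_eq_card_div_card {G H : Type*} [AddGroup G]
    [MeasurableSpace G] [MeasurableAdd G] [AddGroup H] [Fintype H]
    (μ : MeasureTheory.Measure G) [μ.IsAddLeftInvariant] [MeasureTheory.IsProbabilityMeasure μ]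
    (φ : G →+ H) (hφ : Function.Surjective φ) (hm : ∀ h, MeasurableSet (φ ⁻¹' {h}))
    (S : Finset H) :
    (μ (φ ⁻¹' (S : Set H))).toReal = (S.card : ℝ) / Fintype.card H := by
  have hfib : ∀ h, μ (φ ⁻¹' {h}) = μ (φ ⁻¹' {0}) := by
    intro h
    obtain ⟨g, rfl⟩ := hφ h
    rw [← MeasureTheory.measure_preimage_add μ g (φ ⁻¹' {φ g})]
    congr 1
    ext x
    simp
  have hsum : ∀ S : Finset H,
      (μ (φ ⁻¹' (S : Set H))).toReal = S.card * (μ (φ ⁻¹' {0})).toReal := by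
    intro S
    have hU : φ ⁻¹' (S : Set H) = ⋃ h ∈ S, φ ⁻¹' {h} := by
      ext x
      simp
    rw [hU, MeasureTheory.measure_biUnion_finset _ fun h _ ↦ hm h]
    · simp [hfib]
    · intro a _ b _ hab
      exact Disjoint.preimage φ (by simpa using hab)
  have h1 := hsum Finset.univ
  have hcard : (Fintype.card H : ℝ) ≠ 0 := by
    exact_mod_cast Fintype.card_ne_zero
  simp only [Finset.coe_univ, Set.preimage_univ, MeasureTheory.measure_univ,
    ENNReal.toReal_one, Finset.card_univ] at h1
  rw [hsum S, eq_div_iff hcard, mul_assoc, mul_comm _ (Fintype.card H : ℝ), ← h1, mul_one]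

section FiniteField

variable {F : Type*} [Field F] [Fintype F] [DecidableEq F]

theorem sum_quadraticChar_mul_quadraticChar_sub (hF : ringChar F ≠ 2) (b : F) :
    ∑ u, quadraticChar F u * quadraticChar F (b - u) =
      quadraticChar F (-1) * ((if b = 0 then (Fintype.card F : ℤ) else 0) - 1) := by
  split_ifs with hb
  · subst hb
    have h : ∀ u : F, quadraticChar F u * quadraticChar F (0 - u) =
        quadraticChar F (-1) * (1 - if u = 0 then 1 else 0) := by
      intro u
      split_ifs with hu
      · simp [hu]
      · rw [zero_sub, ← neg_one_mul u, map_mul, mul_left_comm, ← sq, quadraticChar_sq_one hu]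
        ring
    rw [Finset.sum_congr rfl fun u _ ↦ h u, ← Finset.mul_sum, Finset.sum_sub_distrib]
    simp
  · have hχ := quadraticChar_ne_one hF
    have hJ := jacobiSum_nontrivial_inv hχ
    rw [(quadraticChar_isQuadratic F).inv, jacobiSum] at hJ
    rw [← Equiv.sum_comp (Equiv.mulLeft₀ b hb)]
    have h : ∀ u : F, quadraticChar F (b * u) * quadraticChar F (b - b * u) =
        quadraticChar F u * quadraticChar F (1 - u) := by
      intro u
      rw [show b - b * u = b * (1 - u) by ring, map_mul, map_mul, mul_mul_mul_comm, ← sq,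
        quadraticChar_sq_one hb, one_mul]
    refine (Finset.sum_congr rfl fun u _ ↦ h u).trans ?_
    rw [hJ]
    ring

theorem sum_indicator_sq_eq (hF : ringChar F ≠ 2) (a : F) :
    ∑ x : F, (if x ^ 2 = a then (1 : ℤ) else 0) = quadraticChar F a + 1 := by
  rw [← quadraticChar_card_sqrts hF a, Finset.sum_boole]
  congr 2
  ext x
  simp

/-- The number of representations of an element of a finite field as a sum of two squares. -/
theorem sum_indicator_sq_add_sq_eq (hF : ringChar F ≠ 2) (b : F) :
    ∑ x : F, ∑ y : F, (if x ^ 2 + y ^ 2 = b then (1 : ℤ) else 0) =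
      Fintype.card F - quadraticChar F (-1) +
        Fintype.card F * quadraticChar F (-1) * if b = 0 then 1 else 0 := by
  have h : ∀ x y : F, (if x ^ 2 + y ^ 2 = b then (1 : ℤ) else 0) =
      ∑ u : F, (if x ^ 2 = u then 1 else 0) * if y ^ 2 = b - u then 1 else 0 := by
    intro x y
    simp only [ite_mul, one_mul, zero_mul, Finset.sum_ite_eq, Finset.mem_univ, if_true,
      eq_sub_iff_add_eq']
  have h2 : ∑ u : F, quadraticChar F (b - u) = 0 := by
    rw [← quadraticChar_sum_zero hF]
    exact Equiv.sum_comp (Equiv.subLeft b) fun u ↦ quadraticChar F u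
  calc ∑ x : F, ∑ y : F, (if x ^ 2 + y ^ 2 = b then (1 : ℤ) else 0)
      = ∑ u : F, (∑ x : F, if x ^ 2 = u then (1 : ℤ) else 0) *
          ∑ y : F, if y ^ 2 = b - u then 1 else 0 := by
        simp_rw [h, Finset.sum_mul_sum]
        conv_rhs => rw [Finset.sum_comm]
        exact Finset.sum_congr rfl fun x _ ↦ Finset.sum_comm
    _ = ∑ u : F, (quadraticChar F u * quadraticChar F (b - u) + quadraticChar F u +
          quadraticChar F (b - u) + 1) := by
        refine Finset.sum_congr rfl fun u _ ↦ ?_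
        rw [sum_indicator_sq_eq hF, sum_indicator_sq_eq hF]
        ring
    _ = _ := by
        simp only [Finset.sum_add_distrib, sum_quadraticChar_mul_quadraticChar_sub hF,
          quadraticChar_sum_zero hF, h2, Finset.sum_const, Finset.card_univ]
        split_ifs <;> simp <;> ring

/-- The number of zeros in `F ^ t` of the quadratic form `∑ i, v i ^ 2`. -/
def sumSqZeros (F : Type*) [Field F] [Fintype F] [DecidableEq F] (t : ℕ) : ℤ :=
  ∑ v : Fin t → F, if ∑ i, v i ^ 2 = 0 then 1 else 0

theorem sumSqZeros_add_two (hF : ringChar F ≠ 2) (t : ℕ) :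
    sumSqZeros F (t + 2) =
      (Fintype.card F - quadraticChar F (-1)) * Fintype.card F ^ t +
        Fintype.card F * quadraticChar F (-1) * sumSqZeros F t := by
  have h : ∀ v : Fin t → F,
      ∑ x : F, ∑ y : F, (if x ^ 2 + (y ^ 2 + ∑ i, v i ^ 2) = 0 then (1 : ℤ) else 0) =
        Fintype.card F - quadraticChar F (-1) +
          Fintype.card F * quadraticChar F (-1) * if ∑ i, v i ^ 2 = 0 then 1 else 0 := by
    intro v
    simpa only [← add_assoc, eq_neg_iff_add_eq_zero, neg_eq_zero] using
      sum_indicator_sq_add_sq_eq hF (-∑ i, v i ^ 2)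
  calc sumSqZeros F (t + 2)
      = ∑ x : F, ∑ y : F, ∑ v : Fin t → F,
          if x ^ 2 + (y ^ 2 + ∑ i, v i ^ 2) = 0 then 1 else 0 := by
        rw [sumSqZeros, ← Equiv.sum_comp (Fin.consEquiv fun _ ↦ F), Fintype.sum_prod_type]
        refine Finset.sum_congr rfl fun x _ ↦ ?_
        rw [← Equiv.sum_comp (Fin.consEquiv fun _ ↦ F), Fintype.sum_prod_type]
        simp [Fin.consEquiv, Fin.sum_univ_succ (n := t), Fin.sum_univ_succ (n := t + 1)]
    _ = ∑ v : Fin t → F, ∑ x : F, ∑ y : F,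
          if x ^ 2 + (y ^ 2 + ∑ i, v i ^ 2) = 0 then 1 else 0 := by
        conv_rhs => rw [Finset.sum_comm]
        exact Finset.sum_congr rfl fun x _ ↦ Finset.sum_comm
    _ = _ := by
        simp only [h, sumSqZeros, Finset.sum_add_distrib, ← Finset.mul_sum, Finset.sum_const,
          Finset.card_univ, Fintype.card_pi, Finset.prod_const, Fintype.card_fin]
        simp [mul_comm]

theorem sumSqZeros_odd (hF : ringChar F ≠ 2) (m : ℕ) :
    sumSqZeros F (2 * m + 1) = Fintype.card F ^ (2 * m) := by
  induction m with
  | zero =>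
    rw [sumSqZeros, ← Equiv.sum_comp (Equiv.funUnique (Fin 1) F).symm]
    simp
  | succ m ih =>
    rw [show 2 * (m + 1) + 1 = 2 * m + 1 + 2 by ring, sumSqZeros_add_two hF, ih]
    ring

theorem sumSqZeros_even (hF : ringChar F ≠ 2) (m : ℕ) :
    sumSqZeros F (2 * (m + 1)) = Fintype.card F ^ (2 * m + 1) +
      quadraticChar F (-1) ^ (m + 1) * (Fintype.card F - 1) * Fintype.card F ^ m := by
  induction m with
  | zero =>
    rw [show 2 * (0 + 1) = 0 + 2 by ring, sumSqZeros_add_two hF]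
    simp [sumSqZeros]
    ring
  | succ m ih =>
    rw [show 2 * (m + 1 + 1) = 2 * (m + 1) + 2 by ring, sumSqZeros_add_two hF, ih]
    ring

end FiniteField

namespace PadicInt

variable {p : ℕ} [Fact p.Prime]

theorem toZMod_eq_zero_iff_norm_lt_one (x : ℤ_[p]) : toZMod x = 0 ↔ ‖x‖ < 1 := by
  rw [← RingHom.mem_ker, ker_toZMod, IsLocalRing.mem_maximalIdeal, mem_nonunits]

theorem isUnit_iff_toZMod_ne_zero (x : ℤ_[p]) : IsUnit x ↔ toZMod x ≠ 0 := by
  rw [Ne, toZMod_eq_zero_iff_norm_lt_one, ← not_isUnit_iff, not_not]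

theorem isOpen_toZMod_preimage_singleton (a : ZMod p) :
    IsOpen ((toZMod : ℤ_[p] →+* ZMod p) ⁻¹' {a}) := by
  obtain ⟨y, rfl⟩ := ZMod.ringHom_surjective (toZMod : ℤ_[p] →+* ZMod p) a
  convert Metric.isOpen_ball (x := y) (ε := 1) using 1
  ext x
  rw [Set.mem_preimage, Set.mem_singleton_iff, ← sub_eq_zero, ← map_sub,
    toZMod_eq_zero_iff_norm_lt_one, Metric.mem_ball, dist_eq_norm]

end PadicInt

theorem measureReal_isUnit_sum_sq {ℓ : ℕ} [Fact ℓ.Prime] (t : ℕ)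
    (τ : MeasureTheory.Measure (Fin t → ℤ_[ℓ])) [τ.IsAddLeftInvariant]
    [MeasureTheory.IsProbabilityMeasure τ] :
    (τ {α | (∃ k, ¬ (ℓ : ℤ_[ℓ]) ∣ α k) ∧ IsUnit (∑ k, α k ^ 2)}).toReal =
      1 - (sumSqZeros (ZMod ℓ) t : ℝ) / (ℓ : ℝ) ^ t := by
  let φ : (Fin t → ℤ_[ℓ]) →+ (Fin t → ZMod ℓ) :=
    (PadicInt.toZMod : ℤ_[ℓ] →+* ZMod ℓ).toAddMonoidHom.compLeft (Fin t)
  have hφ : ∀ α k, φ α k = PadicInt.toZMod (α k) := fun _ _ ↦ rfl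
  have hsurj : Function.Surjective φ :=
    (ZMod.ringHom_surjective (PadicInt.toZMod : ℤ_[ℓ] →+* ZMod ℓ)).comp_left
  have hm : ∀ v, MeasurableSet (φ ⁻¹' {v}) := by
    intro v
    have hv : φ ⁻¹' {v} =
        Set.univ.pi fun k ↦ (PadicInt.toZMod : ℤ_[ℓ] →+* ZMod ℓ) ⁻¹' {v k} := by
      ext α
      simp [funext_iff, hφ]
    rw [hv]
    exact MeasurableSet.univ_pi fun k ↦
      (PadicInt.isOpen_toZMod_preimage_singleton (v k)).measurableSet
  have hset : {α : Fin t → ℤ_[ℓ] | (∃ k, ¬ (ℓ : ℤ_[ℓ]) ∣ α k) ∧ IsUnit (∑ k, α k ^ 2)} =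
      φ ⁻¹' (({v | ¬ ∑ k, v k ^ 2 = 0} : Finset (Fin t → ZMod ℓ)) : Set (Fin t → ZMod ℓ)) := by
    ext α
    simp only [Set.mem_ofPred_eq, Set.mem_preimage, Finset.coe_filter, Finset.mem_univ, true_and,
      hφ, PadicInt.isUnit_iff_toZMod_ne_zero, map_sum, map_pow, and_iff_right_iff_imp]
    contrapose!
    intro h
    refine Finset.sum_eq_zero fun k _ ↦ ?_
    rw [(PadicInt.toZMod_eq_zero_iff_norm_lt_one _).2 ((PadicInt.norm_lt_one_iff_dvd _).2 (h k))]
    simp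
  have hcard := Finset.card_filter_add_card_filter_not (s := Finset.univ)
    (fun v : Fin t → ZMod ℓ ↦ ∑ k, v k ^ 2 = 0)
  have hpos : (ℓ : ℝ) ^ t ≠ 0 := pow_ne_zero _ (by exact_mod_cast (Fact.out : ℓ.Prime).ne_zero)
  rw [hset, measureReal_preimage_finset_eq_card_div_card τ φ hsurj hm, sumSqZeros,
    Finset.sum_boole]
  rw [Finset.card_univ] at hcard
  rw [Fintype.card_pi, Finset.prod_const, Finset.card_univ, Fintype.card_fin, ZMod.card]
    at hcard ⊢
  have hcard' := congrArg (Nat.cast : ℕ → ℝ) hcard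
  push_cast at hcard' ⊢
  rw [eq_sub_iff_add_eq, ← add_div, add_comm, hcard', div_self hpos]

/-- exact formula for the probability (w.r.t. the Haar probability measure on
`ℤ_ℓ^t`, conditioned on the admissible set of measure `1 - ℓ^{-t}`) that
`α_1² + ⋯ + α_t² ∈ ℤ_ℓ^×`, i.e. that the bouquet tower attached to `α` has `μ = 0` and
`λ = 1`. -/
theorem prob_mu_zero_lambda_one_bouquet
    (ℓ : ℕ) [Fact ℓ.Prime] (hℓ : Odd ℓ) (t : ℕ) (ht : 2 ≤ t)
    (τ : MeasureTheory.Measure (Fin t → ℤ_[ℓ]))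
    [τ.IsAddHaarMeasure] [MeasureTheory.IsProbabilityMeasure τ] :
    (Even t →
      (τ {α : Fin t → ℤ_[ℓ] | (∃ k, ¬ (ℓ : ℤ_[ℓ]) ∣ α k) ∧ IsUnit (∑ k, α k ^ 2)}).toReal /
          (1 - ((ℓ : ℝ) ^ t)⁻¹) =
        1 - ((ℓ : ℝ) ^ (t - 1) +
            (-1 : ℝ) ^ (t * (ℓ - 1) / 4) * ((ℓ : ℝ) - 1) * (ℓ : ℝ) ^ (t / 2 - 1) - 1) /
          ((ℓ : ℝ) ^ t - 1)) ∧
    (Odd t →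
      (τ {α : Fin t → ℤ_[ℓ] | (∃ k, ¬ (ℓ : ℤ_[ℓ]) ∣ α k) ∧ IsUnit (∑ k, α k ^ 2)}).toReal /
          (1 - ((ℓ : ℝ) ^ t)⁻¹) =
        1 - ((ℓ : ℝ) ^ (t - 1) - 1) / ((ℓ : ℝ) ^ t - 1)) := by
  have hp : ℓ.Prime := Fact.out
  have hF : ringChar (ZMod ℓ) ≠ 2 := by
    rw [ZMod.ringChar_zmod_n]
    rintro rfl
    exact absurd hℓ (by decide)
  have hℓ1 : (1 : ℝ) < ℓ := by exact_mod_cast hp.one_lt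
  have hq : (ℓ : ℝ) ^ t ≠ 0 := by positivity
  have hq1 : (ℓ : ℝ) ^ t - 1 ≠ 0 := (sub_pos.2 (one_lt_pow₀ hℓ1 (by omega))).ne'
  have key : ∀ Z N : ℝ, Z = N →
      (1 - Z / (ℓ : ℝ) ^ t) / (1 - ((ℓ : ℝ) ^ t)⁻¹) = 1 - (N - 1) / ((ℓ : ℝ) ^ t - 1) := by
    rintro Z _ rfl
    have h : 1 - ((ℓ : ℝ) ^ t)⁻¹ = ((ℓ : ℝ) ^ t - 1) / (ℓ : ℝ) ^ t := by field_simp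
    rw [h]
    field_simp
    ring
  rw [measureReal_isUnit_sum_sq]
  constructor
  · rintro ⟨m, rfl⟩
    obtain ⟨m, rfl⟩ : ∃ n, m = n + 1 := ⟨m - 1, by omega⟩
    refine key _ _ ?_
    have hexp : (m + 1 + (m + 1)) * (ℓ - 1) / 4 = ℓ / 2 * (m + 1) := by
      obtain ⟨k, rfl⟩ := hℓ
      rw [show (2 * k + 1) / 2 = k by omega, show 2 * k + 1 - 1 = 2 * k by omega,
        show (m + 1 + (m + 1)) * (2 * k) = 4 * (k * (m + 1)) by ring]
      omega
    rw [hexp, pow_mul, ← two_mul, sumSqZeros_even hF, quadraticChar_neg_one hF, ZMod.card,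
      ZMod.χ₄_eq_neg_one_pow (Nat.odd_iff.1 hℓ), show 2 * (m + 1) - 1 = 2 * m + 1 by omega,
      show 2 * (m + 1) / 2 - 1 = m by omega]
    push_cast
    ring
  · rintro ⟨m, rfl⟩
    refine key _ _ ?_
    rw [sumSqZeros_odd hF, ZMod.card, Nat.add_sub_cancel]
    push_cast
    rfl
end

section
/- Let ℓ ≥ 5 be a prime and let N be the number of nonzero triples (x_1, x_2, x_3) ∈ F_ℓ³ \ {(0,0,0)} satisfying both x_1² + x_2² + x_3² = 0 and x_1⁴ + x_2⁴ + x_3⁴ = 0. Then N = 8(ℓ − 1) if ℓ ≡ 1 (mod 3), and N = 0 if ℓ ≡ 2 (mod 3). (Consequently, for the bouquet X_3 the probability of μ = 0 and λ = 5 equals 8/(ℓ² + ℓ + 1) when ℓ ≡ 1 (mod 3) and 0 when ℓ ≡ 2 (mod 3).) -/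
section QuarticSystem

variable {F : Type*} [Field F]

theorem exists_sq_add_self_add_one_eq_zero_iff [Fintype F] (h3 : (3 : F) ≠ 0) :
    (∃ w : F, w ^ 2 + w + 1 = 0) ↔ 3 ∣ Fintype.card F - 1 := by
  classical
  have : Fact (Nat.Prime 3) := ⟨Nat.prime_three⟩
  constructor
  · rintro ⟨w, hw⟩
    have hw0 : w ≠ 0 := by rintro rfl; simp at hw
    have h1 : w ≠ 1 := by rintro rfl; exact h3 (by linear_combination hw)
    have hc : w ^ 3 = 1 := by linear_combination (w - 1) * hw
    rw [← orderOf_eq_prime hc h1]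
    exact orderOf_dvd_of_pow_eq_one (FiniteField.pow_card_sub_one_eq_one w hw0)
  · intro h
    rw [← Fintype.card_units] at h
    obtain ⟨u, hu⟩ := exists_prime_orderOf_dvd_card 3 h
    have hc : (u : F) ^ 3 = 1 := by
      have := pow_orderOf_eq_one u
      rw [hu] at this
      rw [← Units.val_pow_eq_pow_val, this, Units.val_one]
    have h1 : (u : F) - 1 ≠ 0 := by
      intro h
      have : u = 1 := Units.ext (sub_eq_zero.mp h)
      simp [this] at hu
    exact ⟨u, (mul_eq_zero.mp (show ((u : F) - 1) * ((u : F) ^ 2 + u + 1) = 0 by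
      linear_combination hc)).resolve_left h1⟩

theorem quartic_system_iff (h2 : (2 : F) ≠ 0) (x y z : F) :
    ((x ≠ 0 ∨ y ≠ 0 ∨ z ≠ 0) ∧ x ^ 2 + y ^ 2 + z ^ 2 = 0 ∧ x ^ 4 + y ^ 4 + z ^ 4 = 0) ↔
      x ≠ 0 ∧ ∃ w d e : F, w ^ 2 + w + 1 = 0 ∧ d ^ 2 = 1 ∧ e ^ 2 = 1 ∧
        y = d * w * x ∧ z = e * w ^ 2 * x := by
  constructor
  · rintro ⟨hne, hsq, hqu⟩
    have hxy : x ^ 4 + x ^ 2 * y ^ 2 + y ^ 4 = 0 := by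
      apply mul_left_cancel₀ h2
      linear_combination hqu + (x ^ 2 + y ^ 2 - z ^ 2) * hsq
    have hx : x ≠ 0 := by
      rintro rfl
      have hy : y = 0 := by simpa using hxy
      subst hy
      have hz : z = 0 := by simpa using hsq
      simp [hz] at hne
    refine ⟨hx, ?_⟩
    -- The ratio of `y ^ 2` to `x ^ 2` is a primitive cube root of unity, with square root its square.
    obtain ⟨w, hw⟩ : ∃ w : F, w = (y / x) ^ 4 := ⟨_, rfl⟩
    obtain ⟨t, ht⟩ : ∃ t : F, t = y / x := ⟨_, rfl⟩
    obtain ⟨s, hs⟩ : ∃ s : F, s = z / x := ⟨_, rfl⟩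
    have hy : y = t * x := by rw [ht]; field_simp
    have hz : z = s * x := by rw [hs]; field_simp
    rw [← ht] at hw
    have htt : t ^ 4 + t ^ 2 + 1 = 0 := by
      apply mul_left_cancel₀ (pow_ne_zero 4 hx)
      rw [hy] at hxy
      linear_combination hxy
    have hst : 1 + t ^ 2 + s ^ 2 = 0 := by
      apply mul_left_cancel₀ (pow_ne_zero 2 hx)
      rw [hy, hz] at hsq
      linear_combination hsq
    have ht6 : t ^ 6 = 1 := by linear_combination (t ^ 2 - 1) * htt
    have hss : s ^ 2 = t ^ 4 := by linear_combination hst - htt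
    subst hw
    refine ⟨t ^ 4, t ^ 3, s * t ^ 4, ?_, ?_, ?_, ?_, ?_⟩
    · linear_combination htt + t ^ 2 * ht6
    · linear_combination ht6
    · linear_combination t ^ 8 * hss + (t ^ 6 + 1) * ht6
    · rw [hy]; linear_combination (-x * t) * ht6
    · rw [hz]; linear_combination (-x * s) * (t ^ 6 + 1) * ht6
  · rintro ⟨hx, w, d, e, hw, hd, he, rfl, rfl⟩
    have hc : w ^ 3 = 1 := by linear_combination (w - 1) * hw
    refine ⟨Or.inl hx, ?_, ?_⟩
    · linear_combination x ^ 2 * (w ^ 2 * hd + w ^ 4 * he + w * hc + hw)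
    · linear_combination x ^ 4 * (w ^ 4 * (d ^ 2 + 1) * hd + w ^ 8 * (e ^ 2 + 1) * he +
        (w + w ^ 5 + w ^ 2) * hc + hw)

theorem card_filter_sq_add_self_add_one_eq_zero [Fintype F] [DecidableEq F] (h3 : (3 : F) ≠ 0)
    (h : 3 ∣ Fintype.card F - 1) :
    (Finset.univ.filter fun w : F ↦ w ^ 2 + w + 1 = 0).card = 2 := by
  obtain ⟨w, hw⟩ := (exists_sq_add_self_add_one_eq_zero_iff h3).mpr h
  rw [Finset.card_eq_two]
  refine ⟨w, -1 - w, ?_, ?_⟩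
  · intro h
    exact h3 (by linear_combination 4 * hw - (2 * w + 1) * h)
  · ext v
    simp only [Finset.mem_filter, Finset.mem_univ, true_and, Finset.mem_insert,
      Finset.mem_singleton]
    constructor
    · intro hv
      have : (v - w) * (v - (-1 - w)) = 0 := by linear_combination hv - hw
      exact (mul_eq_zero.mp this).imp sub_eq_zero.mp sub_eq_zero.mp
    · rintro (rfl | rfl)
      · exact hw
      · linear_combination hw

theorem ncard_quartic_system [Fintype F] [DecidableEq F] (h2 : (2 : F) ≠ 0) :
    Set.ncard {x : Fin 3 → F | x ≠ 0 ∧ (∑ i, x i ^ 2) = 0 ∧ (∑ i, x i ^ 4) = 0} =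
      4 * (Finset.univ.filter fun w : F ↦ w ^ 2 + w + 1 = 0).card * (Fintype.card F - 1) := by
  have hsigns : ({1, -1} : Finset F).card = 2 :=
    Finset.card_pair fun h ↦ h2 (by linear_combination h)
  have hmem (d : F) : d ∈ ({1, -1} : Finset F) ↔ d ^ 2 = 1 := by
    simp
  let P : Finset (F × F × F × F) := (Finset.univ.erase 0) ×ˢ
    (Finset.univ.filter fun w : F ↦ w ^ 2 + w + 1 = 0) ×ˢ {1, -1} ×ˢ {1, -1}
  let f : F × F × F × F → Fin 3 → F := fun p ↦
    ![p.1, p.2.2.1 * p.2.1 * p.1, p.2.2.2 * p.2.1 ^ 2 * p.1]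
  have himage : {x : Fin 3 → F | x ≠ 0 ∧ (∑ i, x i ^ 2) = 0 ∧ (∑ i, x i ^ 4) = 0} =
      f '' (P : Set (F × F × F × F)) := by
    ext x
    have hx : x ≠ 0 ↔ x 0 ≠ 0 ∨ x 1 ≠ 0 ∨ x 2 ≠ 0 := by
      simp [Function.ne_iff, Fin.exists_fin_succ]
    rw [Set.mem_ofPred_eq, hx, Fin.sum_univ_three, Fin.sum_univ_three, quartic_system_iff h2]
    constructor
    · rintro ⟨h0, w, d, e, hw, hd, he, h1, h2⟩
      refine ⟨(x 0, w, d, e), ?_, ?_⟩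
      · simp only [P, Finset.mem_coe, Finset.mem_product, hmem]
        simp [h0, hw, hd, he]
      · ext i
        fin_cases i <;> simp [f, h1, h2]
    · rintro ⟨⟨u, w, d, e⟩, hp, rfl⟩
      simp only [P, Finset.mem_coe, Finset.mem_product, hmem, Finset.mem_erase,
        Finset.mem_filter, Finset.mem_univ, true_and, and_true] at hp
      exact ⟨hp.1, w, d, e, hp.2.1, hp.2.2.1, hp.2.2.2, rfl, rfl⟩
  have hinj : Set.InjOn f P := by
    rintro ⟨u, w, d, e⟩ hp ⟨u', w', d', e'⟩ hp' h
    simp only [P, Finset.mem_coe, Finset.mem_product, hmem, Finset.mem_erase,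
      Finset.mem_filter, Finset.mem_univ, true_and, and_true] at hp hp'
    obtain ⟨hu, hw, hd, he⟩ := hp
    obtain ⟨-, hw', hd', he'⟩ := hp'
    obtain rfl : u = u' := congrFun h 0
    have h1 : d * w = d' * w' := mul_right_cancel₀ hu (congrFun h 1)
    have h2 : e * w ^ 2 = e' * w' ^ 2 := mul_right_cancel₀ hu (congrFun h 2)
    obtain rfl : w = w' := by
      linear_combination hw - hw' + w ^ 2 * hd - w' ^ 2 * hd' - (d * w + d' * w') * h1
    have hw0 : w ≠ 0 := by rintro rfl; simp at hw
    rw [mul_right_cancel₀ hw0 h1, mul_right_cancel₀ (pow_ne_zero 2 hw0) h2]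
  rw [himage, hinj.ncard_image, Set.ncard_coe_finset]
  simp only [P, Finset.card_product, hsigns, Finset.card_erase_of_mem (Finset.mem_univ _),
    Finset.card_univ]
  ring

end QuarticSystem

/-- for a prime `ℓ ≥ 5`, the number `N` of nonzero triples
`(x₁,x₂,x₃) ∈ F_ℓ³` with `x₁² + x₂² + x₃² = 0` and `x₁⁴ + x₂⁴ + x₃⁴ = 0` equals `8(ℓ-1)`
if `ℓ ≡ 1 (mod 3)` and `0` if `ℓ ≡ 2 (mod 3)`. -/
theorem count_solutions_quartic_system
    (ℓ : ℕ) (hp : ℓ.Prime) (hℓ : 5 ≤ ℓ) (N : ℕ)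
    (hN : N = Set.ncard {x : Fin 3 → ZMod ℓ |
      x ≠ 0 ∧ (∑ i, x i ^ 2) = 0 ∧ (∑ i, x i ^ 4) = 0}) :
    (ℓ % 3 = 1 → N = 8 * (ℓ - 1)) ∧ (ℓ % 3 = 2 → N = 0) := by
  have : Fact ℓ.Prime := ⟨hp⟩
  have hcast (n : ℕ) (h0 : 0 < n) (hn : n < ℓ) : (n : ZMod ℓ) ≠ 0 := by
    rw [Ne, ZMod.natCast_eq_zero_iff]
    exact Nat.not_dvd_of_pos_of_lt h0 hn
  have h2 : (2 : ZMod ℓ) ≠ 0 := by exact_mod_cast hcast 2 (by norm_num) (by omega)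
  have h3 : (3 : ZMod ℓ) ≠ 0 := by exact_mod_cast hcast 3 (by norm_num) (by omega)
  rw [ncard_quartic_system h2, ZMod.card] at hN
  constructor
  · intro h
    rw [hN, card_filter_sq_add_self_add_one_eq_zero h3 (by rw [ZMod.card]; omega)]
  · intro h
    have hempty : (Finset.univ.filter fun w : ZMod ℓ ↦ w ^ 2 + w + 1 = 0) = ∅ := by
      refine Finset.filter_eq_empty_iff.mpr fun w _ hw ↦ ?_
      have := (exists_sq_add_self_add_one_eq_zero_iff h3).mp ⟨w, hw⟩
      rw [ZMod.card] at this
      omega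
    rw [hN, hempty]
    simp
end

section
/- Fix an odd prime ℓ and a real number δ ∈ (0,1). For a real number x > 0, let A_{≤x} be the (finite) set of pairs (t, α) where t is a positive integer with t ≤ x^δ and α = (α_1,…,α_t) ∈ ℤ^t satisfies max{|α_1|,…,|α_t|} ≤ x and ℓ ∤ α_i for at least one i; and let T_{≤x} ⊆ A_{≤x} be the subset of pairs (t, α) which in addition satisfy ℓ ∤ (α_1² + ⋯ + α_t²). Then lim_{x→∞} (#T_{≤x} / #A_{≤x}) = 1 − ℓ^{−1}. (The condition ℓ ∤ Σ α_i² is exactly that the ℤ_ℓ-tower of the bouquet X_t attached to α has Iwasawa invariants μ = 0 and λ = 1.) -/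
namespace BouquetTower

open Finset Filter Topology

/-- The integer vectors of length `t` with all coordinates in `[-N, N]`. -/
noncomputable def box (N t : ℕ) : Finset (Fin t → ℤ) :=
  Fintype.piFinset fun _ => Icc (-(N : ℤ)) N

lemma card_box (N t : ℕ) : (box N t).card = (2 * N + 1) ^ t := by
  have h : ((N : ℤ) + 1 + N).toNat = 2 * N + 1 := by omega
  simp [box, h]

/-- Cancellation between the residue classes of `0` and `1` in a sum over `[-N, N]`. -/
lemma norm_sum_Icc_le {ℓ : ℕ} (hℓ : 2 ≤ ℓ) (N : ℕ) (f : ℤ → ℂ) (hf : ∀ a, ‖f a‖ ≤ 1) {d : ℝ}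
    (hd : ∀ j : ℤ, ‖f (ℓ * j) + f (ℓ * j + 1)‖ ≤ d) :
    ‖∑ a ∈ Icc (-(N : ℤ)) N, f a‖ ≤ (2 * N + 1 : ℝ) - (2 - d) * (N / ℓ : ℕ) := by
  set m := N / ℓ with hm
  have hℓm : ℓ * m ≤ N := Nat.mul_div_le N ℓ
  have hℓ0 : ℓ ≠ 0 := by omega
  set P := (range m).image fun j : ℕ => (ℓ : ℤ) * j with hP
  set Q := (range m).image fun j : ℕ => (ℓ : ℤ) * j + 1 with hQ
  have hinjP : Function.Injective fun j : ℕ => (ℓ : ℤ) * j := fun a b h => by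
    simpa [hℓ0] using h
  have hinjQ : Function.Injective fun j : ℕ => (ℓ : ℤ) * j + 1 := fun a b h => by
    simpa [hℓ0] using h
  have hdisj : Disjoint P Q := by
    rw [disjoint_left]
    intro a ha hb
    simp only [hP, hQ, mem_image, mem_range] at ha hb
    obtain ⟨i, -, rfl⟩ := ha
    obtain ⟨j, -, hj⟩ := hb
    have h1 : (ℓ : ℤ) ∣ 1 := ⟨i - j, by linarith⟩
    have := Int.le_of_dvd one_pos h1
    omega
  have hsub : P ∪ Q ⊆ Icc (-(N : ℤ)) N := by
    intro a ha
    simp only [hP, hQ, mem_union, mem_image, mem_range] at ha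
    have key : ∀ j < m, (ℓ : ℤ) * j + 1 ≤ N := fun j hj => by
      have : ℓ * (j + 1) ≤ ℓ * m := Nat.mul_le_mul_left _ hj
      have h2 : ℓ * j + 1 ≤ N := by nlinarith
      exact_mod_cast h2
    have hnn : ∀ j : ℕ, (0 : ℤ) ≤ ℓ * j := fun j => by positivity
    rw [mem_Icc]
    rcases ha with ⟨j, hj, rfl⟩ | ⟨j, hj, rfl⟩ <;> have := key j hj <;> have := hnn j <;>
      constructor <;> omega
  have hcard : ((Icc (-(N : ℤ)) N \ (P ∪ Q)).card : ℝ) = 2 * N + 1 - 2 * m := by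
    have h1 := card_sdiff_add_card_eq_card hsub
    rw [card_union_of_disjoint hdisj, card_image_of_injective _ hinjP,
      card_image_of_injective _ hinjQ, card_range, Int.card_Icc] at h1
    have h2 : (Icc (-(N : ℤ)) N \ (P ∪ Q)).card + 2 * m = 2 * N + 1 := by omega
    have h3 : ((Icc (-(N : ℤ)) N \ (P ∪ Q)).card : ℝ) + 2 * m = 2 * N + 1 := by exact_mod_cast h2
    linarith
  rw [← sum_sdiff hsub, sum_union hdisj, sum_image hinjP.injOn, sum_image hinjQ.injOn,
    ← sum_add_distrib]
  calc _ ≤ ∑ a ∈ Icc (-(N : ℤ)) N \ (P ∪ Q), (1 : ℝ) + ∑ j ∈ range m, d :=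
        norm_add_le_of_le (norm_sum_le_of_le _ fun a _ => hf a)
          (norm_sum_le_of_le _ fun j _ => hd j)
    _ = _ := by
        simp only [sum_const, nsmul_eq_mul, mul_one, hcard, card_range]
        ring

lemma le_four_mul_div {ℓ N : ℕ} (hℓ : 0 < ℓ) (hN : ℓ ≤ N) : 2 * N + 1 ≤ 4 * ℓ * (N / ℓ) := by
  have h1 := Nat.lt_mul_div_succ N hℓ
  have h2 : 1 ≤ N / ℓ := (Nat.one_le_div_iff hℓ).2 hN
  nlinarith

lemma addChar_sum_eq_prod {ι A M : Type*} [AddCommMonoid A] [CommMonoid M] (ψ : AddChar A M)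
    (s : Finset ι) (f : ι → A) : ψ (∑ i ∈ s, f i) = ∏ i ∈ s, ψ (f i) := by
  classical
  induction s using Finset.induction_on with
  | empty => simp
  | insert i s hi ih => rw [sum_insert hi, prod_insert hi, AddChar.map_add_eq_mul, ih]

lemma card_filter_sum_sq (ℓ : ℕ) [NeZero ℓ] (N t : ℕ) :
    (ℓ : ℂ) * ((box N t).filter fun α => (ℓ : ℤ) ∣ ∑ i, α i ^ 2).card =
      ∑ k : ZMod ℓ, (∑ a ∈ Icc (-(N : ℤ)) N, ZMod.stdAddChar (k * (a : ZMod ℓ) ^ 2)) ^ t := by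
  have h1 : ∀ k : ZMod ℓ,
      (∑ a ∈ Icc (-(N : ℤ)) N, (ZMod.stdAddChar (k * (a : ZMod ℓ) ^ 2) : ℂ)) ^ t =
        ∑ α ∈ box N t, ZMod.stdAddChar (k * ((∑ i, α i ^ 2 : ℤ) : ZMod ℓ)) := by
    intro k
    have := Finset.prod_univ_sum (fun _ : Fin t => Icc (-(N : ℤ)) N)
      (fun _ a => (ZMod.stdAddChar (k * (a : ZMod ℓ) ^ 2) : ℂ))
    rw [prod_const, card_univ, Fintype.card_fin] at this
    rw [this]
    refine sum_congr rfl fun α _ => ?_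
    push_cast
    rw [mul_sum]
    exact (addChar_sum_eq_prod _ _ _).symm
  simp_rw [h1]
  rw [sum_comm]
  simp_rw [AddChar.sum_mulShift _ (ZMod.isPrimitive_stdAddChar ℓ), ZMod.card,
    ZMod.intCast_zmod_eq_zero_iff_dvd]
  rw [card_filter]
  push_cast
  rw [mul_sum]
  refine sum_congr rfl fun α _ => ?_
  split_ifs <;> simp

lemma exists_norm_one_add_stdAddChar_le (ℓ : ℕ) [NeZero ℓ] :
    ∃ d : ℝ, 1 ≤ d ∧ d < 2 ∧ ∀ k : ZMod ℓ, k ≠ 0 → ‖1 + (ZMod.stdAddChar k : ℂ)‖ ≤ d := by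
  have h : ∀ k : ZMod ℓ, k ≠ 0 → ‖1 + (ZMod.stdAddChar k : ℂ)‖ < 2 := by
    intro k hk
    have hne : (1 : ℂ) ≠ ZMod.stdAddChar k := fun h =>
      hk (ZMod.injective_stdAddChar (by rw [← h, AddChar.map_zero_eq_one]))
    have hn : ‖(ZMod.stdAddChar k : ℂ)‖ = 1 := AddChar.norm_apply _ _
    have hray : ¬ SameRay ℝ (1 : ℂ) (ZMod.stdAddChar k) := by
      rw [sameRay_iff_of_norm_eq (by rw [hn, norm_one])]
      exact hne
    have := norm_add_lt_of_not_sameRay hray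
    rw [norm_one, hn] at this
    linarith
  have hev : ∀ᶠ d : ℝ in 𝓝[<] 2, ∀ k : ZMod ℓ, k ≠ 0 → ‖1 + (ZMod.stdAddChar k : ℂ)‖ ≤ d := by
    rw [eventually_all]
    intro k
    by_cases hk : k = 0
    · simp [hk]
    · filter_upwards [Ioo_mem_nhdsLT (h k hk)] with d hd _ using hd.1.le
  obtain ⟨d, hd, hd'⟩ := (hev.and (Ioo_mem_nhdsLT (show (1 : ℝ) < 2 by norm_num))).exists
  exact ⟨d, hd'.1.le, hd'.2, hd⟩

/-- Equidistribution of sums of squares modulo `ℓ` on boxes, with exponentially small error,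
together with the scarcity of vectors divisible by `ℓ`. -/
lemma exists_card_bounds {ℓ : ℕ} (hp : ℓ.Prime) :
    ∃ c : ℝ, 1 / 2 ≤ c ∧ c < 1 ∧ ∀ N t : ℕ, ℓ ≤ N →
      |(((box N t).filter fun α => ¬ (ℓ : ℤ) ∣ ∑ i, α i ^ 2).card : ℝ) -
          (1 - (ℓ : ℝ)⁻¹) * (2 * N + 1) ^ t| ≤ (c * (2 * N + 1)) ^ t ∧
      |(((box N t).filter fun α => ∃ i, ¬ (ℓ : ℤ) ∣ α i).card : ℝ) - (2 * N + 1) ^ t| ≤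
        (c * (2 * N + 1)) ^ t := by
  have : NeZero ℓ := ⟨hp.ne_zero⟩
  have hℓ2 := hp.two_le
  have hℓR : (2 : ℝ) ≤ ℓ := by exact_mod_cast hℓ2
  obtain ⟨d, hd1, hd2, hd⟩ := exists_norm_one_add_stdAddChar_le ℓ
  have hfrac : (2 - d) / (4 * ℓ) ≤ 1 / 2 := by
    rw [div_le_iff₀ (by positivity)]; linarith
  have hfrac0 : 0 < (2 - d) / (4 * ℓ) := div_pos (by linarith) (by positivity)
  refine ⟨1 - (2 - d) / (4 * ℓ), by linarith, by linarith, fun N t hN => ?_⟩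
  set c := 1 - (2 - d) / (4 * ℓ) with hc
  have hm : (2 * N + 1 : ℝ) - (2 - d) * (N / ℓ : ℕ) ≤ c * (2 * N + 1) := by
    have h1 : (2 * N + 1 : ℝ) ≤ 4 * ℓ * (N / ℓ : ℕ) := by
      exact_mod_cast le_four_mul_div hp.pos hN
    have h2 := mul_le_mul_of_nonneg_left h1 hfrac0.le
    have h3 : (2 - d) / (4 * ℓ) * (4 * ℓ * (N / ℓ : ℕ)) = (2 - d) * (N / ℓ : ℕ) := by
      field_simp
    rw [h3] at h2
    rw [hc]
    linarith
  have hsplit : ∀ p : (Fin t → ℤ) → Prop, [DecidablePred p] →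
      (((box N t).filter fun α => p α).card : ℝ) + ((box N t).filter fun α => ¬ p α).card =
        (2 * N + 1) ^ t := fun p _ => by
    have := card_filter_add_card_filter_not (s := box N t) p
    rw [card_box] at this
    exact_mod_cast this
  constructor
  · have hS : ∀ k : ZMod ℓ, k ≠ 0 →
        ‖∑ a ∈ Icc (-(N : ℤ)) N, (ZMod.stdAddChar (k * (a : ZMod ℓ) ^ 2) : ℂ)‖ ≤
          c * (2 * N + 1) := fun k hk =>
      (norm_sum_Icc_le hℓ2 N _ (fun a => (AddChar.norm_apply _ _).le)
        (fun j => by simpa using hd k hk)).trans hm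
    have hF := card_filter_sum_sq ℓ N t
    rw [← add_sum_erase _ _ (mem_univ (0 : ZMod ℓ))] at hF
    have h0 : ((N : ℤ) + 1 + N).toNat = 2 * N + 1 := by omega
    simp only [zero_mul, AddChar.map_zero_eq_one, sum_const, Int.card_Icc, sub_neg_eq_add, h0,
      nsmul_eq_mul, mul_one] at hF
    have hE : ‖∑ k ∈ univ.erase (0 : ZMod ℓ),
        (∑ a ∈ Icc (-(N : ℤ)) N, (ZMod.stdAddChar (k * (a : ZMod ℓ) ^ 2) : ℂ)) ^ t‖ ≤
          ℓ * (c * (2 * N + 1)) ^ t := by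
      calc _ ≤ ∑ k ∈ univ.erase (0 : ZMod ℓ), (c * (2 * N + 1)) ^ t :=
            norm_sum_le_of_le _ fun k hk => by
              rw [norm_pow]
              exact pow_le_pow_left₀ (norm_nonneg _) (hS k (ne_of_mem_erase hk)) t
        _ ≤ ∑ k : ZMod ℓ, (c * (2 * N + 1)) ^ t := by
            refine sum_le_sum_of_subset_of_nonneg (erase_subset _ _) fun _ _ _ => ?_
            have : 0 ≤ c := by linarith
            positivity
        _ = _ := by simp [ZMod.card]
    rw [← sub_eq_iff_eq_add'.2 hF] at hE
    have hZ := hsplit fun α => (ℓ : ℤ) ∣ ∑ i, α i ^ 2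
    set Z := ((box N t).filter fun α => (ℓ : ℤ) ∣ ∑ i, α i ^ 2).card
    set Y := ((box N t).filter fun α => ¬ (ℓ : ℤ) ∣ ∑ i, α i ^ 2).card
    have hE' : |(ℓ : ℝ) * Z - (2 * N + 1) ^ t| ≤ ℓ * (c * (2 * N + 1)) ^ t := by
      rw [← Real.norm_eq_abs, ← Complex.norm_real]
      push_cast at hE ⊢
      exact hE
    have hY : (Y : ℝ) - (1 - (ℓ : ℝ)⁻¹) * (2 * N + 1) ^ t =
        -((ℓ : ℝ)⁻¹ * (ℓ * Z - (2 * N + 1) ^ t)) := by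
      rw [← hZ]
      field_simp
      ring
    rw [hY, abs_neg, abs_mul, abs_of_pos (by positivity), inv_mul_le_iff₀ (by positivity)]
    exact hE'
  · have hA := hsplit fun α => ∀ i, (ℓ : ℤ) ∣ α i
    simp only [not_forall] at hA
    have hpi : ((box N t).filter fun α => ∀ i, (ℓ : ℤ) ∣ α i) =
        Fintype.piFinset fun _ => (Icc (-(N : ℤ)) N).filter fun a => (ℓ : ℤ) ∣ a := by
      ext α
      simp [box, Fintype.mem_piFinset, forall_and]
    have hn := norm_sum_Icc_le hℓ2 N (fun a => if (ℓ : ℤ) ∣ a then 1 else 0)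
      (fun a => by split_ifs <;> simp) (d := 1) (fun j => by
        have : ¬ (ℓ : ℤ) ∣ 1 := fun h => by
          have := Int.le_of_dvd one_pos h
          omega
        simp [Int.dvd_add_right, this])
    rw [sum_boole, Complex.norm_natCast] at hn
    have hn' : (((Icc (-(N : ℤ)) N).filter fun a => (ℓ : ℤ) ∣ a).card : ℝ) ≤ c * (2 * N + 1) := by
      refine hn.trans (le_trans ?_ hm)
      have : (0 : ℝ) ≤ (N / ℓ : ℕ) := by positivity
      nlinarith
    have hB : (((box N t).filter fun α => ∀ i, (ℓ : ℤ) ∣ α i).card : ℝ) ≤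
        (c * (2 * N + 1)) ^ t := by
      rw [hpi, Fintype.card_piFinset_const]
      push_cast
      exact pow_le_pow_left₀ (by positivity) hn' t
    rw [← hA, sub_add_cancel_right, abs_neg, abs_of_nonneg (by positivity)]
    exact hB

lemma ncard_sigma_eq {x δ : ℝ} (hx : 0 ≤ x) (p : ∀ t : ℕ, (Fin t → ℤ) → Prop)
    [∀ t, DecidablePred (p t)] :
    Set.ncard {q : Σ t : ℕ, Fin t → ℤ | 0 < q.1 ∧ (q.1 : ℝ) ≤ x ^ δ ∧
      (∀ i, |(q.2 i : ℝ)| ≤ x) ∧ p q.1 q.2} =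
      ∑ t ∈ Icc 1 ⌊x ^ δ⌋₊, ((box ⌊x⌋₊ t).filter (p t)).card := by
  rw [← card_sigma, ← Set.ncard_coe_finset]
  congr 1
  ext ⟨t, α⟩
  have habs : ∀ a : ℤ, |(a : ℝ)| ≤ x ↔ -(⌊x⌋₊ : ℤ) ≤ a ∧ a ≤ ⌊x⌋₊ := fun a => by
    rw [← abs_le, Int.natCast_floor_eq_floor hx, Int.le_floor, Int.cast_abs]
  simp only [Set.mem_ofPred_eq, coe_sigma, Set.mem_sigma_iff, mem_coe, mem_Icc, mem_filter, box,
    Fintype.mem_piFinset, habs, Nat.le_floor_iff (Real.rpow_nonneg hx δ), Nat.succ_le_iff,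
    and_assoc]

/-- A sum of terms `κ M ^ t` up to an error `(c M) ^ t` is dominated by its last term. -/
lemma abs_sum_div_sub_le {c M κ : ℝ} (hM : 1 ≤ M) (hcM : 1 ≤ c * M) {T : ℕ} (hT : 1 ≤ T)
    {u : ℕ → ℝ} (hu : ∀ t, |u t - κ * M ^ t| ≤ (c * M) ^ t) :
    |(∑ t ∈ Icc 1 T, u t) / (∑ t ∈ Icc 1 T, M ^ t) - κ| ≤ T * c ^ T := by
  have hM0 : 0 < M := by linarith
  have hlast : M ^ T ≤ ∑ t ∈ Icc 1 T, M ^ t :=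
    single_le_sum (f := fun t => M ^ t) (fun t _ => by positivity) (mem_Icc.2 ⟨hT, le_rfl⟩)
  have hP : 0 < ∑ t ∈ Icc 1 T, M ^ t := lt_of_lt_of_le (by positivity) hlast
  have hc : 0 < c := pos_of_mul_pos_left (by linarith) hM0.le
  rw [div_sub' hP.ne', abs_div, abs_of_pos hP, div_le_iff₀ hP, mul_comm _ κ, mul_sum,
    ← sum_sub_distrib]
  calc _ ≤ ∑ t ∈ Icc 1 T, (c * M) ^ T := (abs_sum_le_sum_abs _ _).trans
        (sum_le_sum fun t ht => (hu t).trans (pow_le_pow_right₀ hcM (mem_Icc.1 ht).2))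
    _ = T * c ^ T * M ^ T := by simp [mul_pow, mul_assoc]
    _ ≤ _ := by gcongr

lemma tendsto_sum_div {c κ δ : ℝ} (hδ : 0 < δ) (hc : 1 / 2 ≤ c) (hc1 : c < 1) {n₀ : ℕ}
    {u : ℕ → ℕ → ℝ}
    (hu : ∀ N t, n₀ ≤ N → |u N t - κ * (2 * N + 1) ^ t| ≤ (c * (2 * N + 1)) ^ t) :
    Tendsto (fun x : ℝ => (∑ t ∈ Icc 1 ⌊x ^ δ⌋₊, u ⌊x⌋₊ t) /
      ∑ t ∈ Icc 1 ⌊x ^ δ⌋₊, (2 * (⌊x⌋₊ : ℝ) + 1) ^ t) atTop (𝓝 κ) := by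
  have hT : Tendsto (fun x : ℝ => ⌊x ^ δ⌋₊) atTop atTop :=
    tendsto_nat_floor_atTop.comp (tendsto_rpow_atTop hδ)
  have hN : Tendsto (fun x : ℝ => ⌊x⌋₊) atTop atTop := tendsto_nat_floor_atTop
  rw [tendsto_iff_norm_sub_tendsto_zero]
  refine squeeze_zero' (Eventually.of_forall fun _ => norm_nonneg _) ?_
    ((tendsto_self_mul_const_pow_of_lt_one (by linarith) hc1).comp hT)
  filter_upwards [hT.eventually_ge_atTop 1, hN.eventually_ge_atTop n₀,
    hN.eventually_ge_atTop 1] with x h1 h2 h3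
  have h3' : (1 : ℝ) ≤ ⌊x⌋₊ := by exact_mod_cast h3
  exact abs_sum_div_sub_le (by linarith) (by nlinarith) h1 fun t => hu _ t h2

end BouquetTower


/-- fix an odd prime `ℓ` and `δ ∈ (0,1)`.  Among pairs `(t, α)` with `t ≤ x^δ`
a positive integer and `α ∈ ℤ^t` admissible (some `α_i` prime to `ℓ`) with all `|α_i| ≤ x`,
the proportion of those with `ℓ ∤ α_1² + ⋯ + α_t²` — i.e. those whose bouquet tower has
`μ = 0` and `λ = 1` — tends to `1 - ℓ⁻¹` as `x → ∞`. -/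
theorem density_mu_zero_lambda_one_varying_t
    (ℓ : ℕ) (hp : ℓ.Prime) (hℓ : Odd ℓ) (δ : ℝ) (hδ0 : 0 < δ) (hδ1 : δ < 1) :
    Filter.Tendsto
      (fun x : ℝ =>
        ((Set.ncard {p : Σ t : ℕ, Fin t → ℤ | 0 < p.1 ∧ (p.1 : ℝ) ≤ x ^ δ ∧
            (∀ i, |(p.2 i : ℝ)| ≤ x) ∧ (∃ i, ¬ (ℓ : ℤ) ∣ p.2 i) ∧
            ¬ (ℓ : ℤ) ∣ (∑ i, p.2 i ^ 2)} : ℝ) /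
          (Set.ncard {p : Σ t : ℕ, Fin t → ℤ | 0 < p.1 ∧ (p.1 : ℝ) ≤ x ^ δ ∧
            (∀ i, |(p.2 i : ℝ)| ≤ x) ∧ ∃ i, ¬ (ℓ : ℤ) ∣ p.2 i} : ℝ)))
      Filter.atTop (nhds (1 - (ℓ : ℝ)⁻¹)) := by
  classical
  obtain ⟨c, hc, hc1, hb⟩ := BouquetTower.exists_card_bounds hp
  have hT := BouquetTower.tendsto_sum_div hδ0 hc hc1 fun N t hN => (hb N t hN).1
  have hA := BouquetTower.tendsto_sum_div (κ := 1) hδ0 hc hc1 fun N t hN => by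
    simpa using (hb N t hN).2
  have hlim := hT.div hA one_ne_zero
  rw [div_one] at hlim
  refine hlim.congr' ?_
  filter_upwards [Filter.eventually_ge_atTop (1 : ℝ)] with x hx
  have hx0 : 0 ≤ x := by linarith
  have hTx : {p : Σ t : ℕ, Fin t → ℤ | 0 < p.1 ∧ (p.1 : ℝ) ≤ x ^ δ ∧
      (∀ i, |(p.2 i : ℝ)| ≤ x) ∧ (∃ i, ¬ (ℓ : ℤ) ∣ p.2 i) ∧ ¬ (ℓ : ℤ) ∣ (∑ i, p.2 i ^ 2)} =
      {p : Σ t : ℕ, Fin t → ℤ | 0 < p.1 ∧ (p.1 : ℝ) ≤ x ^ δ ∧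
        (∀ i, |(p.2 i : ℝ)| ≤ x) ∧ ¬ (ℓ : ℤ) ∣ (∑ i, p.2 i ^ 2)} := by
    ext p
    have : ¬ (ℓ : ℤ) ∣ (∑ i, p.2 i ^ 2) → ∃ i, ¬ (ℓ : ℤ) ∣ p.2 i := fun h => by
      by_contra! hall
      exact h (Finset.dvd_sum fun i _ => dvd_pow (hall i) two_ne_zero)
    simp only [Set.mem_ofPred_eq]
    tauto
  rw [hTx, BouquetTower.ncard_sigma_eq hx0 fun _ α => ¬ (ℓ : ℤ) ∣ ∑ i, α i ^ 2,
    BouquetTower.ncard_sigma_eq hx0 fun _ α => ∃ i, ¬ (ℓ : ℤ) ∣ α i]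
  have hP : (∑ t ∈ Finset.Icc 1 ⌊x ^ δ⌋₊, (2 * (⌊x⌋₊ : ℝ) + 1) ^ t) ≠ 0 := by
    have h1 : 1 ≤ ⌊x ^ δ⌋₊ := Nat.le_floor (by simpa using Real.one_le_rpow hx hδ0.le)
    exact (Finset.sum_pos (fun t _ => by positivity) ⟨1, by simpa using h1⟩).ne'
  simp only [Pi.div_apply]
  rw [div_div_div_cancel_right₀ hP]
  push_cast
  congr!
end

section
/- Let ℓ be an odd prime and let p, q ≥ 0, e ≥ 1, g ≥ 0 be integers with r := e + g ≥ 1; set t := p + q + r − 1. Over F_ℓ, consider the quadratic form Q in the t variables x_1,…,x_p, y_2,…,y_e, z_1,…,z_g, w_1,…,w_q given by Q = (Σ_{i=2}^e y_i − Σ_{j=1}^g z_j)² − r·(Σ_{i=1}^p x_i² + Σ_{j=2}^e y_j² + Σ_{k=1}^g z_k² + Σ_{n=1}^q w_n²), with associated symmetric bilinear form ⟨u,v⟩ = (Q(u+v) − Q(u) − Q(v))/2. Then: (1) if ℓ | r, the form Q is degenerate of rank 1 (the symmetric matrix of ⟨·,·⟩ has rank 1); (2) if ℓ ∤ r, the form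 Q is nondegenerate, i.e. its symmetric matrix has rank t (equivalently, ⟨u, ·⟩ = 0 forces u = 0). -/
/-- Index type for the `t = p + (e-1) + g + q` variables `x_1,…,x_p, y_2,…,y_e,
z_1,…,z_g, w_1,…,w_q` of the two-vertex quadratic form. -/
abbrev TwoVertexIndex (p e g q : ℕ) : Type :=
  Fin p ⊕ (Fin (e - 1) ⊕ (Fin g ⊕ Fin q))

/-- The quadratic form `Q = (Σ y_i - Σ z_j)² - r·(Σ x_i² + Σ y_j² + Σ z_k² + Σ w_n²)`
over `F_ℓ` attached to a two-vertex multigraph. -/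
def twoVertexForm (ℓ p e g q r : ℕ) (u : TwoVertexIndex p e g q → ZMod ℓ) : ZMod ℓ :=
  ((∑ i : Fin (e - 1), u (Sum.inr (Sum.inl i))) -
      ∑ j : Fin g, u (Sum.inr (Sum.inr (Sum.inl j)))) ^ 2 -
    (r : ZMod ℓ) * ∑ i, u i ^ 2

/-- The symmetric matrix of the bilinear form `⟨u,v⟩ = (Q(u+v) - Q(u) - Q(v))/2`
associated to the quadratic form `Q`, evaluated on the standard basis vectors. -/
def twoVertexMatrix (ℓ p e g q r : ℕ) [Fact ℓ.Prime] :
    Matrix (TwoVertexIndex p e g q) (TwoVertexIndex p e g q) (ZMod ℓ) :=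
  fun i j =>
    (twoVertexForm ℓ p e g q r (Pi.single i 1 + Pi.single j 1) -
        twoVertexForm ℓ p e g q r (Pi.single i 1) -
        twoVertexForm ℓ p e g q r (Pi.single j 1)) / 2

/-- The coefficients of the linear form `Σ y_i - Σ z_j` occurring in `twoVertexForm`. -/
def twoVertexSign (R : Type*) [Ring R] (p e g q : ℕ) : TwoVertexIndex p e g q → R :=
  Sum.elim 0 (Sum.elim 1 (Sum.elim (-1) 0))

open Matrix

theorem twoVertexForm_eq_dotProduct (ℓ p e g q r : ℕ) (u : TwoVertexIndex p e g q → ZMod ℓ) :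
    twoVertexForm ℓ p e g q r u =
      (twoVertexSign (ZMod ℓ) p e g q ⬝ᵥ u) ^ 2 - (r : ZMod ℓ) * (u ⬝ᵥ u) := by
  simp [twoVertexForm, twoVertexSign, dotProduct, Fintype.sum_sum_type, sub_eq_add_neg, sq]

theorem twoVertexSign_dotProduct_self (R : Type*) [Ring R] (p e g q : ℕ) :
    twoVertexSign R p e g q ⬝ᵥ twoVertexSign R p e g q = ((e - 1 + g : ℕ) : R) := by
  simp [twoVertexSign, dotProduct, Fintype.sum_sum_type]

theorem twoVertexMatrix_eq (ℓ p e g q r : ℕ) [Fact ℓ.Prime] (hℓ : Odd ℓ) :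
    twoVertexMatrix ℓ p e g q r =
      vecMulVec (twoVertexSign (ZMod ℓ) p e g q) (twoVertexSign (ZMod ℓ) p e g q) -
        (r : ZMod ℓ) • (1 : Matrix _ _ (ZMod ℓ)) := by
  have h2 : (2 : ZMod ℓ) ≠ 0 := by
    apply Ring.two_ne_zero
    rw [ZMod.ringChar_zmod_n]
    rintro rfl
    exact absurd hℓ (by decide)
  ext i j
  simp only [twoVertexMatrix, twoVertexForm_eq_dotProduct, dotProduct_add,
    dotProduct_single, Matrix.sub_apply, Matrix.smul_apply, vecMulVec_apply, Matrix.one_apply,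
    Pi.single_apply, Pi.add_apply, smul_eq_mul, mul_one, eq_comm (a := j) (b := i), if_true]
  rw [div_eq_iff h2]
  ring

/-- the quadratic form `Q` in `t = p + q + r - 1` variables attached to a
two-vertex multigraph (with `r = e + g` connecting edges) is degenerate of rank `1` if
`ℓ ∣ r`, and nondegenerate (of rank `t`) if `ℓ ∤ r`. -/
theorem twoVertexForm_rank
    (ℓ : ℕ) [Fact ℓ.Prime] (hℓ : Odd ℓ) (p q e g r t : ℕ) (he : 1 ≤ e) (hr : r = e + g)
    (hr1 : 1 ≤ r) (ht : t = p + q + r - 1) :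
    (ℓ ∣ r → (twoVertexMatrix ℓ p e g q r).rank = 1) ∧
    (¬ ℓ ∣ r → (twoVertexMatrix ℓ p e g q r).rank = t) := by
  have hc := twoVertexSign_dotProduct_self (ZMod ℓ) p e g q
  rw [twoVertexMatrix_eq ℓ p e g q r hℓ]
  set c := twoVertexSign (ZMod ℓ) p e g q with c_def
  have hcr : c ⬝ᵥ c = (r : ZMod ℓ) - 1 := by
    rw [hc, show r = (e - 1 + g) + 1 by omega]
    push_cast
    ring
  refine ⟨fun h => ?_, fun h => ?_⟩
  · have hr0 : (r : ZMod ℓ) = 0 := (ZMod.natCast_eq_zero_iff r ℓ).2 h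
    rw [hr0, zero_smul, sub_zero]
    refine le_antisymm (rank_vecMulVec_le c c) (Nat.one_le_iff_ne_zero.2 fun h0 => ?_)
    have hcc : c = 0 := by
      rw [Matrix.rank, Submodule.finrank_eq_zero, LinearMap.range_eq_bot, ← toLin'_apply',
        LinearEquiv.map_eq_zero_iff, vecMulVec_eq_zero, or_self] at h0
      exact h0
    rw [hcc, hr0] at hcr
    simp at hcr
  · have hr0 : (r : ZMod ℓ) ≠ 0 := mt (ZMod.natCast_eq_zero_iff r ℓ).1 h
    rw [rank_of_isUnit]
    · simp only [Fintype.card_sum, Fintype.card_fin]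
      omega
    rw [← mulVec_injective_iff_isUnit, ← coe_mulVecLin, injective_iff_map_eq_zero]
    intro v hv
    have hv' : (c ⬝ᵥ v) • c = (r : ZMod ℓ) • v := by
      rw [mulVecLin_apply, sub_mulVec, vecMulVec_mulVec, smul_mulVec, one_mulVec] at hv
      simpa using sub_eq_zero.1 hv
    have hcv : c ⬝ᵥ v = 0 := by
      have := congrArg (c ⬝ᵥ ·) hv'
      simp only [dotProduct_smul, hcr, smul_eq_mul] at this
      linear_combination -this
    rw [hcv, zero_smul] at hv'
    exact (smul_eq_zero.1 hv'.symm).resolve_left hr0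
end

section
/- Let ℓ be an odd prime, and let p, q ≥ 0, e ≥ 1, g ≥ 0 be integers with r := e + g ≥ 1; set t := p + q + r − 1 and assume t ≥ 1. Let Q be the quadratic form over F_ℓ in t variables Q = (Σ_{i=2}^e y_i − Σ_{j=1}^g z_j)² − r·(Σ_{i=1}^p x_i² + Σ_{j=2}^e y_j² + Σ_{k=1}^g z_k² + Σ_{n=1}^q w_n²), and let τ be the Haar probability measure on ℤ_ℓ^t. Define Prob_ℓ(μ=0, λ=1) := τ({α ∈ ℤ_ℓ^t \ (ℓℤ_ℓ)^t : Q(α mod ℓ) ≠ 0 in F_ℓ}) / (1 − ℓ^{−t}). Then: (1) if ℓ | r, Prob_ℓ(μ=0, λ=1) = 1 − (1 − ℓ^{−t})^{−1}·(ℓ^{−1} − ℓ^{−t}); (2) if ℓ ∤ r, there exists η ∈ {+1, −1} such that Prob_ℓ(μ=0, λ=1) = 1 − (1 − ℓ^{−t})^{−1}·(ℓ^{−1} − ℓ^{−t}) if t is odd, and Prob_ℓ(μ=0, λ=1) = 1 − (1 − ℓ^{−t})^{−1}·(ℓ^{−1} + η·(ℓ−1)·ℓ^{−(t/2+1)} −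 ℓ^{−t}) if t is even. -/
open MeasureTheory

section ZeroCount

variable {F : Type*} [Field F] [Fintype F] [DecidableEq F]

theorem sum_comp_sq_eq_sum_quadraticChar (hF : ringChar F ≠ 2) (h : F → ℤ) :
    ∑ x, h (x ^ 2) = ∑ y, (quadraticChar F y + 1) * h y := by
  rw [← Finset.sum_fiberwise' Finset.univ (fun x : F => x ^ 2) h]
  refine Finset.sum_congr rfl fun y _ => ?_
  rw [Finset.sum_const, nsmul_eq_mul, ← quadraticChar_card_sqrts hF]
  congr 3
  ext x
  simp

theorem sum_quadraticChar_sub_mul_sq (hF : ringChar F ≠ 2) {a : F} (ha : a ≠ 0) (c : F) :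
    ∑ x, quadraticChar F (c - a * x ^ 2) =
      quadraticChar F (-a) * if c = 0 then (Fintype.card F : ℤ) - 1 else -1 := by
  have hχ0 := quadraticChar_sum_zero hF
  have hlin : ∑ y, quadraticChar F (c - a * y) = 0 := by
    rw [← hχ0]
    exact Fintype.sum_equiv ((Equiv.mulLeft₀ a ha).trans (Equiv.subLeft c)) _ _ fun _ => rfl
  rw [sum_comp_sq_eq_sum_quadraticChar hF fun y => quadraticChar F (c - a * y)]
  simp only [add_mul, one_mul, Finset.sum_add_distrib, hlin, add_zero]
  split_ifs with hc
  · subst hc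
    have hterm (y : F) : quadraticChar F y * quadraticChar F (0 - a * y) =
        quadraticChar F (-a) * (1 - if y = 0 then 1 else 0) := by
      split_ifs with hy
      · simp [hy]
      · rw [zero_sub, ← neg_mul, map_mul]
        linear_combination quadraticChar F (-a) * quadraticChar_sq_one hy
    simp only [hterm, ← Finset.mul_sum, Finset.sum_sub_distrib]
    simp
  · have hJ : ∑ z, quadraticChar F z * quadraticChar F (1 - z) = -quadraticChar F (-1) := by
      simpa [jacobiSum, (quadraticChar_isQuadratic F).inv] using
        jacobiSum_nontrivial_inv (quadraticChar_ne_one hF)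
    have hsub : ∑ y, quadraticChar F y * quadraticChar F (c - a * y) =
        ∑ z, quadraticChar F a * (quadraticChar F z * quadraticChar F (1 - z)) := by
      refine (Fintype.sum_equiv (Equiv.mulLeft₀ (c / a) (div_ne_zero hc ha)) _ _ fun z => ?_).symm
      have h1 : c - a * (c / a * z) = c * (1 - z) := by field_simp
      have h2 : c / a * z = c * a * z * (a⁻¹) ^ 2 := by field_simp
      have h3 := quadraticChar_sq_one' (F := F) (inv_ne_zero ha)
      have h4 := quadraticChar_sq_one hc
      simp only [Equiv.mulLeft₀_apply]
      rw [h1, h2]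
      simp only [map_mul, h3, mul_one]
      linear_combination -(quadraticChar F a * quadraticChar F z * quadraticChar F (1 - z)) * h4
    rw [hsub, ← Finset.mul_sum, hJ, neg_eq_neg_one_mul a, map_mul]
    ring

theorem card_diagonal_cons {n : ℕ} (w : Fin (n + 1) → F) (c : F) :
    (Fintype.card {u : Fin (n + 1) → F // ∑ i, w i * u i ^ 2 = c} : ℤ) =
      ∑ x, (Fintype.card {u : Fin n → F // ∑ i, w i.succ * u i ^ 2 = c - w 0 * x ^ 2} : ℤ) := by
  rw [← Nat.cast_sum, ← Fintype.card_sigma]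
  congr 1
  refine Fintype.card_congr
    { toFun := fun u => ⟨u.1 0, Fin.tail u.1, ?_⟩
      invFun := fun s => ⟨Fin.cons s.1 s.2.1, ?_⟩
      left_inv := fun u => by simp
      right_inv := fun ⟨_, _⟩ => rfl }
  · rw [eq_sub_iff_add_eq', Fin.tail_def, ← Fin.sum_univ_succ fun i => w i * u.1 i ^ 2]
    exact u.2
  · rw [Fin.sum_univ_succ]
    simp [s.2.2]

theorem card_diagonal_eq (hF : ringChar F ≠ 2) (m : ℕ) :
    (∀ w : Fin (2 * m) → F, (∀ i, w i ≠ 0) → ∃ η : ℤ, (η = 1 ∨ η = -1) ∧ ∀ c : F,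
      (Fintype.card F : ℤ) * Fintype.card {u : Fin (2 * m) → F // ∑ i, w i * u i ^ 2 = c} =
        Fintype.card F ^ (2 * m) +
          η * (if c = 0 then (Fintype.card F : ℤ) - 1 else -1) * Fintype.card F ^ m) ∧
    (∀ w : Fin (2 * m + 1) → F, (∀ i, w i ≠ 0) → ∃ η : ℤ, (η = 1 ∨ η = -1) ∧ ∀ c : F,
      (Fintype.card F : ℤ) * Fintype.card {u : Fin (2 * m + 1) → F // ∑ i, w i * u i ^ 2 = c} =
        Fintype.card F ^ (2 * m + 1) +
          η * quadraticChar F c * Fintype.card F ^ (m + 1)) := by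
  have odd_of_even (m : ℕ) (ih : ∀ w : Fin (2 * m) → F, (∀ i, w i ≠ 0) →
      ∃ η : ℤ, (η = 1 ∨ η = -1) ∧ ∀ c : F,
      (Fintype.card F : ℤ) * Fintype.card {u : Fin (2 * m) → F // ∑ i, w i * u i ^ 2 = c} =
        Fintype.card F ^ (2 * m) +
          η * (if c = 0 then (Fintype.card F : ℤ) - 1 else -1) * Fintype.card F ^ m)
      (w : Fin (2 * m + 1) → F) (hw : ∀ i, w i ≠ 0) :
      ∃ η : ℤ, (η = 1 ∨ η = -1) ∧ ∀ c : F,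
      (Fintype.card F : ℤ) * Fintype.card {u : Fin (2 * m + 1) → F // ∑ i, w i * u i ^ 2 = c} =
        Fintype.card F ^ (2 * m + 1) +
          η * quadraticChar F c * Fintype.card F ^ (m + 1) := by
    obtain ⟨η, hη, h⟩ := ih (fun i => w i.succ) fun i => hw _
    have hχ := quadraticChar_dichotomy (hw 0)
    refine ⟨η * quadraticChar F (w 0), ?_, fun c => ?_⟩
    · rcases hη with rfl | rfl <;> rcases hχ with h | h <;> simp [h]
    rw [card_diagonal_cons, Finset.mul_sum, Finset.sum_congr rfl fun x _ => h _]
    have hroots : ∑ x, (if c - w 0 * x ^ 2 = 0 then (Fintype.card F : ℤ) - 1 else -1) =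
        Fintype.card F * (quadraticChar F (w 0) * quadraticChar F c) := by
      rw [sum_comp_sq_eq_sum_quadraticChar hF
        fun y => if c - w 0 * y = 0 then (Fintype.card F : ℤ) - 1 else -1]
      have hterm (y : F) : (quadraticChar F y + 1) *
          (if c - w 0 * y = 0 then (Fintype.card F : ℤ) - 1 else -1) =
          (if y = c / w 0 then (quadraticChar F y + 1) * (Fintype.card F : ℤ) else 0) -
            (quadraticChar F y + 1) := by
        have : c - w 0 * y = 0 ↔ y = c / w 0 := by
          rw [sub_eq_zero, eq_div_iff (hw 0), mul_comm, eq_comm]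
        simp only [this]
        split_ifs <;> ring
      have hdiv : quadraticChar F (c / w 0) = quadraticChar F (w 0) * quadraticChar F c := by
        have : c / w 0 = w 0 * c * (w 0)⁻¹ ^ 2 := by
          have := hw 0
          field_simp
        rw [this, map_mul, quadraticChar_sq_one' (inv_ne_zero (hw 0)), map_mul, mul_one]
      simp only [hterm, Finset.sum_sub_distrib, Finset.sum_ite_eq', Finset.sum_add_distrib,
        quadraticChar_sum_zero hF, hdiv]
      simp
      ring
    rw [Finset.sum_add_distrib, ← Finset.sum_mul, ← Finset.mul_sum, hroots]
    simp
    ring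
  induction m with
  | zero =>
    have base : ∀ w : Fin (2 * 0) → F, (∀ i, w i ≠ 0) → ∃ η : ℤ, (η = 1 ∨ η = -1) ∧ ∀ c : F,
      (Fintype.card F : ℤ) * Fintype.card {u : Fin (2 * 0) → F // ∑ i, w i * u i ^ 2 = c} =
        Fintype.card F ^ (2 * 0) +
          η * (if c = 0 then (Fintype.card F : ℤ) - 1 else -1) * Fintype.card F ^ 0 := by
      refine fun w _ => ⟨1, Or.inl rfl, fun c => ?_⟩
      have : Fintype.card {u : Fin (2 * 0) → F // ∑ i, w i * u i ^ 2 = c} =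
          if c = 0 then 1 else 0 := by
        simp only [Nat.mul_zero, Finset.univ_eq_empty, Finset.sum_empty]
        split_ifs with hc
        · simp [hc]
        · simp [Ne.symm hc]
      rw [this]
      split_ifs <;> simp
    exact ⟨base, odd_of_even 0 base⟩
  | succ m ih =>
    have even : ∀ w : Fin (2 * m + 1 + 1) → F, (∀ i, w i ≠ 0) →
        ∃ η : ℤ, (η = 1 ∨ η = -1) ∧ ∀ c : F,
        (Fintype.card F : ℤ) *
            Fintype.card {u : Fin (2 * m + 1 + 1) → F // ∑ i, w i * u i ^ 2 = c} =
          Fintype.card F ^ (2 * m + 1 + 1) +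
            η * (if c = 0 then (Fintype.card F : ℤ) - 1 else -1) * Fintype.card F ^ (m + 1) := by
      intro w hw
      obtain ⟨η, hη, h⟩ := ih.2 (fun i => w i.succ) fun i => hw _
      have hχ := quadraticChar_dichotomy (neg_ne_zero.mpr (hw 0))
      refine ⟨η * quadraticChar F (-w 0), ?_, fun c => ?_⟩
      · rcases hη with rfl | rfl <;> rcases hχ with h | h <;> simp [h]
      rw [card_diagonal_cons, Finset.mul_sum, Finset.sum_congr rfl fun x _ => h _,
        Finset.sum_add_distrib, ← Finset.sum_mul, ← Finset.mul_sum,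
        sum_quadraticChar_sub_mul_sq hF (hw 0)]
      simp only [Finset.sum_const, Finset.card_univ, nsmul_eq_mul]
      ring
    exact ⟨even, odd_of_even (m + 1) even⟩

theorem card_zeros_diagonal (hF : ringChar F ≠ 2) {n : ℕ} (w : Fin n → F) (hw : ∀ i, w i ≠ 0) :
    ∃ η : ℤ, (η = 1 ∨ η = -1) ∧
      (Odd n → (Fintype.card F : ℤ) * Fintype.card {u : Fin n → F // ∑ i, w i * u i ^ 2 = 0} =
        Fintype.card F ^ n) ∧
      (Even n → (Fintype.card F : ℤ) * Fintype.card {u : Fin n → F // ∑ i, w i * u i ^ 2 = 0} =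
        Fintype.card F ^ n + η * (Fintype.card F - 1) * Fintype.card F ^ (n / 2)) := by
  obtain ⟨m, rfl | rfl⟩ := n.even_or_odd'
  · obtain ⟨η, hη, h⟩ := (card_diagonal_eq hF m).1 w hw
    refine ⟨η, hη, fun ho => absurd ho (by simp), fun _ => ?_⟩
    rw [h 0]
    simp
  · obtain ⟨η, hη, h⟩ := (card_diagonal_eq hF m).2 w hw
    refine ⟨η, hη, fun _ => ?_, fun he => absurd he (by simp)⟩
    rw [h 0]
    simp

/-- The number of zeros of a nondegenerate quadratic form over a finite field of odd
characteristic. -/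
theorem QuadraticForm.card_zeros {V : Type*} [AddCommGroup V] [Module F V]
    [FiniteDimensional F V] [Invertible (2 : F)] (hF : ringChar F ≠ 2) (Q : QuadraticForm F V)
    (hQ : (QuadraticMap.associated (R := F) Q).SeparatingLeft) :
    ∃ η : ℤ, (η = 1 ∨ η = -1) ∧
      (Odd (Module.finrank F V) → (Fintype.card F : ℤ) * Nat.card {v // Q v = 0} =
        Fintype.card F ^ Module.finrank F V) ∧
      (Even (Module.finrank F V) → (Fintype.card F : ℤ) * Nat.card {v // Q v = 0} =
        Fintype.card F ^ Module.finrank F V +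
          η * (Fintype.card F - 1) * Fintype.card F ^ (Module.finrank F V / 2)) := by
  obtain ⟨w, ⟨φ⟩⟩ := Q.equivalent_weightedSumSquares_units_of_nondegenerate' hQ
  have hcard : Nat.card {v // Q v = 0} =
      Fintype.card {u : Fin (Module.finrank F V) → F // ∑ i, (w i : F) * u i ^ 2 = 0} := by
    rw [← Nat.card_eq_fintype_card]
    refine Nat.card_congr (φ.toLinearEquiv.toEquiv.subtypeEquiv fun v => ?_)
    rw [← φ.map_app v, QuadraticMap.weightedSumSquares_apply]
    simp [Units.smul_def, sq]
  rw [hcard]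
  exact card_zeros_diagonal hF _ fun i => (w i).ne_zero

/-- The number of zeros of `(v ⬝ u)² - r (u ⬝ u)` when this form is nondegenerate. -/
theorem card_zeros_dotProduct_sq_sub {ι : Type*} [Fintype ι] (hF : ringChar F ≠ 2)
    (v : ι → F) (r : F) (hr : r ≠ 0) (hv : v ⬝ᵥ v ≠ r) :
    ∃ η : ℤ, (η = 1 ∨ η = -1) ∧
      (Odd (Fintype.card ι) →
        (Fintype.card F : ℤ) * Nat.card {u // (v ⬝ᵥ u) ^ 2 - r * (u ⬝ᵥ u) = 0} =
          Fintype.card F ^ Fintype.card ι) ∧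
      (Even (Fintype.card ι) →
        (Fintype.card F : ℤ) * Nat.card {u // (v ⬝ᵥ u) ^ 2 - r * (u ⬝ᵥ u) = 0} =
          Fintype.card F ^ Fintype.card ι +
            η * (Fintype.card F - 1) * Fintype.card F ^ (Fintype.card ι / 2)) := by
  classical
  let B : LinearMap.BilinForm F (ι → F) := LinearMap.mk₂ F
    (fun x y => (v ⬝ᵥ x) * (v ⬝ᵥ y) - r * (x ⬝ᵥ y))
    (fun x x' y => by simp only [dotProduct_add, add_dotProduct]; ring)
    (fun c x y => by simp only [dotProduct_smul, smul_dotProduct, smul_eq_mul]; ring)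
    (fun x y y' => by simp only [dotProduct_add]; ring)
    (fun c x y => by simp only [dotProduct_smul, smul_eq_mul]; ring)
  have hB (x y : ι → F) : B x y = (v ⬝ᵥ x) * (v ⬝ᵥ y) - r * (x ⬝ᵥ y) := rfl
  let _ : Invertible (2 : F) := invertibleOfNonzero (Ring.two_ne_zero hF)
  have hsep : (QuadraticMap.associated (R := F) B.toQuadraticMap).SeparatingLeft := by
    rw [QuadraticMap.associated_left_inverse F fun x y => by
      rw [hB, hB, dotProduct_comm x y]; ring]
    intro x hx
    have hvx : v ⬝ᵥ x = 0 := by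
      have h := hx v
      rw [hB, dotProduct_comm x v, mul_comm, ← sub_mul] at h
      exact (mul_eq_zero.mp h).resolve_left (sub_ne_zero.mpr hv)
    ext i
    simpa [hB, hvx, hr] using hx (Pi.single i 1)
  have := QuadraticForm.card_zeros hF B.toQuadraticMap hsep
  simpa only [Module.finrank_fintype_fun_eq_card, LinearMap.BilinMap.toQuadraticMap_apply, hB,
    ← sq] using this

end ZeroCount

/-- A surjective homomorphism onto a finite group pushes an invariant probability measure forward
to the uniform distribution. -/
theorem measureReal_preimage_of_surjective {G H : Type*} [AddGroup G] [MeasurableSpace G]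
    [MeasurableAdd G] [AddGroup H] [Finite H] (μ : Measure G) [μ.IsAddLeftInvariant]
    [IsProbabilityMeasure μ] (f : G →+ H) (hf : Function.Surjective f)
    (hmeas : ∀ h, MeasurableSet (f ⁻¹' {h})) (S : Set H) :
    μ.real (f ⁻¹' S) = Nat.card S / Nat.card H := by
  classical
  have := Fintype.ofFinite H
  have hconst (h : H) : μ.real (f ⁻¹' {h}) = μ.real (f ⁻¹' {0}) := by
    obtain ⟨g, rfl⟩ := hf h
    rw [measureReal_def, measureReal_def, ← measure_preimage_add μ g (f ⁻¹' {f g})]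
    congr 2
    ext x
    simp
  have hsum (T : Finset H) : μ.real (f ⁻¹' T) = T.card * μ.real (f ⁻¹' {0}) := by
    rw [← sum_measureReal_preimage_singleton T fun y _ => hmeas y,
      Finset.sum_congr rfl fun y _ => hconst y, Finset.sum_const, nsmul_eq_mul]
  have htot : (Nat.card H : ℝ) * μ.real (f ⁻¹' {0}) = 1 := by
    simpa [Nat.card_eq_fintype_card] using (hsum Finset.univ).symm
  have hS := hsum S.toFinset
  rw [Set.coe_toFinset, Set.toFinset_card] at hS
  have hH : (Nat.card H : ℝ) ≠ 0 := Nat.cast_ne_zero.mpr Nat.card_pos.ne'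
  rw [hS, eq_div_iff hH, Nat.card_eq_fintype_card (α := S)]
  linear_combination (Fintype.card S : ℝ) * htot

theorem PadicInt.measurableSet_toZMod_preimage_singleton {ℓ : ℕ} [Fact ℓ.Prime] (c : ZMod ℓ) :
    MeasurableSet ((PadicInt.toZMod : ℤ_[ℓ] →+* ZMod ℓ) ⁻¹' {c}) := by
  obtain ⟨a, rfl⟩ := ZMod.ringHom_surjective (PadicInt.toZMod (p := ℓ)) c
  have : (PadicInt.toZMod : ℤ_[ℓ] →+* ZMod ℓ) ⁻¹' {PadicInt.toZMod a} = Metric.ball a 1 := by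
    ext x
    rw [Set.mem_preimage, Set.mem_singleton_iff, ← sub_eq_zero, ← map_sub, ← RingHom.mem_ker,
      PadicInt.ker_toZMod, IsLocalRing.mem_maximalIdeal, PadicInt.mem_nonunits, Metric.mem_ball,
      dist_eq_norm]
  rw [this]
  exact Metric.isOpen_ball.measurableSet

/-- The measure of a set of `ℓ`-adic vectors defined by a condition modulo `ℓ`. -/
theorem PadicInt.measureReal_setOf_toZMod_mem {ℓ : ℕ} [Fact ℓ.Prime] {ι : Type*} [Fintype ι]
    (τ : Measure (ι → ℤ_[ℓ])) [τ.IsAddHaarMeasure] [IsProbabilityMeasure τ]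
    (S : Set (ι → ZMod ℓ)) :
    τ.real {α | (fun i => PadicInt.toZMod (α i)) ∈ S} = Nat.card S / (ℓ : ℝ) ^ Fintype.card ι := by
  let f : (ι → ℤ_[ℓ]) →+ (ι → ZMod ℓ) :=
    (PadicInt.toZMod (p := ℓ)).toAddMonoidHom.compLeft ι
  have hmeas (v : ι → ZMod ℓ) : MeasurableSet (f ⁻¹' {v}) := by
    have : f ⁻¹' {v} =
        Set.univ.pi fun i => (PadicInt.toZMod : ℤ_[ℓ] →+* ZMod ℓ) ⁻¹' {v i} := by
      ext α
      simp [f, funext_iff]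
    rw [this]
    exact MeasurableSet.univ_pi fun i => measurableSet_toZMod_preimage_singleton _
  have hsurj : Function.Surjective f := fun v => by
    choose a ha using fun i => ZMod.ringHom_surjective (PadicInt.toZMod (p := ℓ)) (v i)
    exact ⟨a, funext ha⟩
  have h := measureReal_preimage_of_surjective τ f hsurj hmeas S
  rwa [Nat.card_fun, Nat.card_zmod, Nat.card_eq_fintype_card (α := ι), Nat.cast_pow] at h

/-- A nonzero linear form on `F^ι` vanishes on a proportion `1 / |F|` of the vectors. -/
theorem card_mul_card_dotProduct_eq_zero {F ι : Type*} [Field F] [Fintype F] [Fintype ι]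
    {v : ι → F} (hv : v ≠ 0) :
    Nat.card F * Nat.card {u // v ⬝ᵥ u = 0} = Nat.card F ^ Fintype.card ι := by
  classical
  let f : (ι → F) →+ F := AddMonoidHom.mk' (v ⬝ᵥ ·) (dotProduct_add v)
  obtain ⟨i, hi⟩ := Function.ne_iff.mp hv
  have hsurj : Function.Surjective f := fun c =>
    ⟨Pi.single i ((v i)⁻¹ * c), by simpa [f] using mul_inv_cancel_left₀ hi c⟩
  have h := f.ker.card_eq_card_quotient_mul_card_addSubgroup
  rw [Nat.card_congr (QuotientAddGroup.quotientKerEquivOfSurjective f hsurj).toEquiv,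
    Nat.card_fun, Nat.card_eq_fintype_card (α := ι)] at h
  exact h.symm

/-- The coefficient vector of the linear form `Σ y_i - Σ z_j`. -/
def twoVertexCoeff (ℓ p e g q : ℕ) : TwoVertexIndex p e g q → ZMod ℓ :=
  Sum.elim 0 (Sum.elim 1 (Sum.elim (-1) 0))

theorem twoVertexForm_eq (ℓ p e g q r : ℕ) (u : TwoVertexIndex p e g q → ZMod ℓ) :
    twoVertexForm ℓ p e g q r u =
      (twoVertexCoeff ℓ p e g q ⬝ᵥ u) ^ 2 - (r : ZMod ℓ) * (u ⬝ᵥ u) := by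
  simp [twoVertexForm, twoVertexCoeff, dotProduct, sq, sub_eq_add_neg]

theorem twoVertexCoeff_dotProduct_self (ℓ p e g q : ℕ) (he : 1 ≤ e) :
    twoVertexCoeff ℓ p e g q ⬝ᵥ twoVertexCoeff ℓ p e g q = ((e + g : ℕ) : ZMod ℓ) - 1 := by
  simp [twoVertexCoeff, dotProduct, Nat.cast_sub he]
  ring

/-- exact formula for the probability (w.r.t. the Haar probability measure on
`ℤ_ℓ^t`, conditioned on the admissible set of measure `1 - ℓ^{-t}`) that the `ℤ_ℓ`-tower of a
two-vertex multigraph has `μ = 0` and `λ = 1`, i.e. that the associated quadratic form `Q`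
does not vanish on the mod-`ℓ` reduction of the voltage vector. -/
theorem prob_mu_zero_lambda_one_two_vertices
    (ℓ : ℕ) [Fact ℓ.Prime] (hℓ : Odd ℓ) (p q e g r t : ℕ) (he : 1 ≤ e) (hr : r = e + g)
    (hr1 : 1 ≤ r) (ht : t = p + q + r - 1) (ht1 : 1 ≤ t)
    (τ : MeasureTheory.Measure (TwoVertexIndex p e g q → ℤ_[ℓ]))
    [τ.IsAddHaarMeasure] [MeasureTheory.IsProbabilityMeasure τ]
    (Prob : ℝ)
    (hProb : Prob =
      (τ {α : TwoVertexIndex p e g q → ℤ_[ℓ] | (∃ i, ¬ (ℓ : ℤ_[ℓ]) ∣ α i) ∧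
          twoVertexForm ℓ p e g q r (fun i => PadicInt.toZMod (α i)) ≠ 0}).toReal /
        (1 - ((ℓ : ℝ) ^ t)⁻¹)) :
    (ℓ ∣ r →
      Prob = 1 - (1 - ((ℓ : ℝ) ^ t)⁻¹)⁻¹ * ((ℓ : ℝ)⁻¹ - ((ℓ : ℝ) ^ t)⁻¹)) ∧
    (¬ ℓ ∣ r →
      ∃ η : ℝ, (η = 1 ∨ η = -1) ∧
        (Odd t →
          Prob = 1 - (1 - ((ℓ : ℝ) ^ t)⁻¹)⁻¹ * ((ℓ : ℝ)⁻¹ - ((ℓ : ℝ) ^ t)⁻¹)) ∧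
        (Even t →
          Prob = 1 - (1 - ((ℓ : ℝ) ^ t)⁻¹)⁻¹ *
            ((ℓ : ℝ)⁻¹ + η * ((ℓ : ℝ) - 1) * ((ℓ : ℝ) ^ (t / 2 + 1))⁻¹ -
              ((ℓ : ℝ) ^ t)⁻¹))) := by
  have hcard : Fintype.card (TwoVertexIndex p e g q) = t := by
    simp only [Fintype.card_sum, Fintype.card_fin]
    omega
  have hℓ0 : (ℓ : ℝ) ≠ 0 := Nat.cast_ne_zero.mpr (Fact.out : ℓ.Prime).ne_zero
  have hden : 1 - ((ℓ : ℝ) ^ t)⁻¹ ≠ 0 :=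
    (sub_pos.mpr (inv_lt_one_of_one_lt₀ (one_lt_pow₀
      (Nat.one_lt_cast.mpr (Fact.out : ℓ.Prime).one_lt) (by omega)))).ne'
  let S : Set (TwoVertexIndex p e g q → ZMod ℓ) := {u | twoVertexForm ℓ p e g q r u = 0}
  have hadm : {α : TwoVertexIndex p e g q → ℤ_[ℓ] | (∃ i, ¬ (ℓ : ℤ_[ℓ]) ∣ α i) ∧
      twoVertexForm ℓ p e g q r (fun i => PadicInt.toZMod (α i)) ≠ 0} =
      {α | (fun i => PadicInt.toZMod (α i)) ∈ Sᶜ} := by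
    ext α
    refine ⟨fun h => h.2, fun h => ⟨?_, h⟩⟩
    by_contra! hdvd
    refine h ?_
    have hzero (i) : PadicInt.toZMod (α i) = 0 := by
      obtain ⟨b, hb⟩ := hdvd i
      simp [hb]
    simp [S, hzero, twoVertexForm]
  have hprob (z : ℝ) (hz : (ℓ : ℝ) * Nat.card S = ℓ ^ t * (ℓ * z)) :
      Prob = 1 - (1 - ((ℓ : ℝ) ^ t)⁻¹)⁻¹ * (z - ((ℓ : ℝ) ^ t)⁻¹) := by
    have hcompl : (Nat.card (Sᶜ : Set _) : ℝ) = (ℓ : ℝ) ^ t - Nat.card S := by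
      have h := S.ncard_add_ncard_compl
      rw [← Nat.card_coe_set_eq, ← Nat.card_coe_set_eq, Nat.card_fun, Nat.card_zmod,
        Nat.card_eq_fintype_card (α := TwoVertexIndex p e g q), hcard] at h
      rw [eq_sub_iff_add_eq']
      exact_mod_cast h
    have hS : (Nat.card S : ℝ) = ℓ ^ t * z :=
      mul_left_cancel₀ hℓ0 (hz.trans (mul_left_comm _ _ _))
    have hτ := PadicInt.measureReal_setOf_toZMod_mem τ Sᶜ
    rw [hcompl, hcard, hS] at hτ
    rw [hProb, hadm, ← measureReal_def, hτ, div_eq_iff hden, sub_mul, mul_right_comm,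
      inv_mul_cancel₀ hden]
    field_simp
    ring
  refine ⟨fun hdvd => hprob _ ?_, fun hndvd => ?_⟩
  · have hr0 : (r : ZMod ℓ) = 0 := (ZMod.natCast_eq_zero_iff r ℓ).mpr hdvd
    have hv : twoVertexCoeff ℓ p e g q ≠ 0 := fun h => by
      have := twoVertexCoeff_dotProduct_self ℓ p e g q he
      rw [h, ← hr, hr0] at this
      simp at this
    have h := card_mul_card_dotProduct_eq_zero hv
    rw [hcard, Nat.card_zmod] at h
    have hS : Nat.card S = Nat.card {u // twoVertexCoeff ℓ p e g q ⬝ᵥ u = 0} :=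
      Nat.card_congr (Equiv.subtypeEquivRight fun u => by simp [S, twoVertexForm_eq, hr0])
    rw [hS, mul_inv_cancel₀ hℓ0, mul_one]
    exact_mod_cast h
  · have hr0 : (r : ZMod ℓ) ≠ 0 := fun h => hndvd ((ZMod.natCast_eq_zero_iff r ℓ).mp h)
    have hF : ringChar (ZMod ℓ) ≠ 2 := by
      rw [ZMod.ringChar_zmod_n]
      rintro rfl
      exact absurd hℓ (by decide)
    obtain ⟨η, hη, hodd, heven⟩ := card_zeros_dotProduct_sq_sub hF (twoVertexCoeff ℓ p e g q)
      (r : ZMod ℓ) hr0 (by simp [twoVertexCoeff_dotProduct_self ℓ p e g q he, ← hr])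
    simp only [hcard, ZMod.card, ← twoVertexForm_eq] at hodd heven
    refine ⟨η, by rcases hη with rfl | rfl <;> simp, fun ht' => hprob _ ?_, fun ht' => hprob _ ?_⟩
    · rw [mul_inv_cancel₀ hℓ0, mul_one]
      exact_mod_cast hodd ht'
    · have h : (ℓ : ℝ) * Nat.card S = ℓ ^ t + η * (ℓ - 1) * ℓ ^ (t / 2) := by
        exact_mod_cast heven ht'
      obtain ⟨m, rfl⟩ := ht'
      have hm : (m + m) / 2 = m := by omega
      rw [hm] at h ⊢
      rw [h, pow_add, pow_succ]
      field_simp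
end

section
/- Let ℓ be an odd prime and let μ₀ ≥ 0 be an integer; let v_ℓ denote the ℓ-adic valuation on positive integers. Then lim_{x→∞} (1/x)·#{u ∈ ℤ : 4 ≤ u ≤ x and v_ℓ(u−2) + (u−3)·v_ℓ(u) = μ₀} equals (ℓ−2)/ℓ if μ₀ = 0, and equals (ℓ−1)/ℓ^{μ₀+1} if μ₀ > 0. (By the determinant computations for complete graphs, v_ℓ(u−2) + (u−3)·v_ℓ(u) = v_ℓ((u−2)·u^{u−3}) is the Iwasawa μ-invariant — and λ = 1 always — of the ℤ_ℓ-tower of the complete graph K_u attached to either the single voltage assignment α(a,u) or the voltage assignment α′(a,u), for any fixed a ∈ ℤ_ℓ^×; so this limit is the density of u for which (μ, λ) = (μ₀, 1) in these families, and the density of u with λ ≠ 1 is 0.) -/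
open Filter Topology in
/-- The residue class of `v` modulo `m` has natural density `1 / m`. -/
theorem tendsto_card_filter_modEq_div (m v : ℕ) (hm : 0 < m) :
    Tendsto (fun x : ℕ => (((Finset.range x).filter (· ≡ v [MOD m])).card : ℝ) / x)
      atTop (𝓝 (1 / m)) := by
  have hm' : (0 : ℝ) < m := by exact_mod_cast hm
  have hlim : Tendsto (fun x : ℕ => (1 : ℝ) / x) atTop (𝓝 0) :=
    tendsto_one_div_atTop_nhds_zero_nat
  have hlow : Tendsto (fun x : ℕ => (1 : ℝ) / m - 1 / x) atTop (𝓝 (1 / m)) := by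
    simpa using tendsto_const_nhds.sub hlim
  have hupp : Tendsto (fun x : ℕ => (1 : ℝ) / m + 1 / x) atTop (𝓝 (1 / m)) := by
    simpa using tendsto_const_nhds.add hlim
  have key (x : ℕ) : (x : ℝ) / m - 1 ≤ ((Finset.range x).filter (· ≡ v [MOD m])).card ∧
      (((Finset.range x).filter (· ≡ v [MOD m])).card : ℝ) ≤ x / m + 1 := by
    rw [← Nat.count_eq_card_filter_range, Nat.count_modEq_card x hm v]
    have hdiv : (x : ℝ) / m = (x / m : ℕ) + (x % m : ℕ) / (m : ℝ) := by
      rw [div_eq_iff hm'.ne', add_mul, div_mul_cancel₀ _ hm'.ne']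
      exact_mod_cast (Nat.div_add_mod' x m).symm
    have h0 : (0 : ℝ) ≤ (x % m : ℕ) / (m : ℝ) := by positivity
    have h1 : ((x % m : ℕ) : ℝ) / m ≤ 1 := by
      rw [div_le_one hm']
      exact_mod_cast (Nat.mod_lt x hm).le
    rw [hdiv]
    push_cast
    split_ifs <;> constructor <;> linarith
  refine tendsto_of_tendsto_of_tendsto_of_le_of_le' hlow hupp ?_ ?_
  all_goals
    filter_upwards [eventually_gt_atTop 0] with x hx
    have hx' : (0 : ℝ) < x := by exact_mod_cast hx
  · rw [le_div_iff₀ hx', sub_mul, div_mul_cancel₀ _ hx'.ne']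
    have := (key x).1
    rwa [div_mul_eq_mul_div, one_mul]
  · rw [div_le_iff₀ hx', add_mul, div_mul_cancel₀ _ hx'.ne']
    have := (key x).2
    rwa [div_mul_eq_mul_div, one_mul]

open Filter Topology in
/-- Natural densities do not change when a predicate is modified at finitely many places. -/
theorem tendsto_card_filter_Icc_div_of_iff (p q : ℕ → Prop) [DecidablePred p] [DecidablePred q]
    (a N : ℕ) (d : ℝ) (h : ∀ u, N ≤ u → (p u ↔ q u))
    (hq : Tendsto (fun x : ℕ => (((Finset.range x).filter q).card : ℝ) / x) atTop (𝓝 d)) :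
    Tendsto (fun x : ℕ => (((Finset.Icc a x).filter p).card : ℝ) / x) atTop (𝓝 d) := by
  have hle (x : ℕ) : ((Finset.Icc a x).filter p).card ≤
      ((Finset.range x).filter q).card + (N + a + 1) := by
    have hsub : (Finset.Icc a x).filter p ⊆
        (Finset.range x).filter q ∪ (Finset.range (N + a) ∪ {x}) := by
      intro u hu
      simp only [Finset.mem_filter, Finset.mem_Icc, Finset.mem_union, Finset.mem_range,
        Finset.mem_singleton] at hu ⊢
      have := h u
      grind
    have h1 := Finset.card_le_card hsub
    have h2 := Finset.card_union_le ((Finset.range x).filter q) (Finset.range (N + a) ∪ {x})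
    have h3 := Finset.card_union_le (Finset.range (N + a)) {x}
    simp only [Finset.card_range, Finset.card_singleton] at h3
    omega
  have hge (x : ℕ) : ((Finset.range x).filter q).card ≤
      ((Finset.Icc a x).filter p).card + (N + a + 1) := by
    have hsub : (Finset.range x).filter q ⊆
        (Finset.Icc a x).filter p ∪ Finset.range (N + a) := by
      intro u hu
      simp only [Finset.mem_filter, Finset.mem_Icc, Finset.mem_union, Finset.mem_range] at hu ⊢
      have := h u
      grind
    have h1 := Finset.card_le_card hsub
    have h2 := Finset.card_union_le ((Finset.Icc a x).filter p) (Finset.range (N + a))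
    simp only [Finset.card_range] at h2
    omega
  have hlim : Tendsto (fun x : ℕ => ((N + a + 1 : ℕ) : ℝ) / x) atTop (𝓝 0) :=
    tendsto_const_div_atTop_nhds_zero_nat _
  have hlow := hq.sub hlim
  have hupp := hq.add hlim
  rw [sub_zero] at hlow
  rw [add_zero] at hupp
  refine tendsto_of_tendsto_of_tendsto_of_le_of_le hlow hupp (fun x => ?_) (fun x => ?_)
  · have := hge x
    rw [← sub_div]
    refine div_le_div_of_nonneg_right ?_ (Nat.cast_nonneg x)
    rw [sub_le_iff_le_add, ← Nat.cast_add]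
    exact Nat.cast_le.2 this
  · have := hle x
    rw [← add_div]
    refine div_le_div_of_nonneg_right ?_ (Nat.cast_nonneg x)
    rw [← Nat.cast_add]
    exact Nat.cast_le.2 this

theorem Nat.modEq_two_iff_dvd_sub {m u : ℕ} (hu : 2 ≤ u) : u ≡ 2 [MOD m] ↔ m ∣ u - 2 :=
  Nat.ModEq.comm.trans (Nat.modEq_iff_dvd' hu)

theorem Nat.Prime.not_dvd_sub_two_of_dvd {ℓ u : ℕ} (hp : ℓ.Prime) (hℓ : Odd ℓ) (hu : 2 ≤ u)
    (h : ℓ ∣ u) : ¬ ℓ ∣ u - 2 := by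
  intro h'
  have h2 : ℓ ∣ 2 := by simpa [Nat.sub_sub_self hu] using Nat.dvd_sub h h'
  rw [(Nat.prime_dvd_prime_iff_eq hp Nat.prime_two).1 h2] at hℓ
  exact absurd hℓ (by decide)

theorem factorization_sub_two_add_eq_zero_iff {ℓ u : ℕ} (hp : ℓ.Prime) (hu : 4 ≤ u) :
    (u - 2).factorization ℓ + (u - 3) * u.factorization ℓ = 0 ↔
      ¬ u ≡ 0 [MOD ℓ] ∧ ¬ u ≡ 2 [MOD ℓ] := by
  rw [Nat.modEq_zero_iff_dvd, Nat.modEq_two_iff_dvd_sub (by omega), Nat.add_eq_zero_iff,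
    Nat.mul_eq_zero, Nat.factorization_eq_zero_iff, Nat.factorization_eq_zero_iff]
  have h1 : u - 3 ≠ 0 := by omega
  have h2 : u - 2 ≠ 0 := by omega
  have h3 : u ≠ 0 := by omega
  tauto

theorem factorization_sub_two_add_eq_iff {ℓ u μ₀ : ℕ} (hp : ℓ.Prime) (hℓ : Odd ℓ) (hμ : 0 < μ₀)
    (hu : μ₀ + 4 ≤ u) :
    (u - 2).factorization ℓ + (u - 3) * u.factorization ℓ = μ₀ ↔
      u ≡ 2 [MOD ℓ ^ μ₀] ∧ ¬ u ≡ 2 [MOD ℓ ^ (μ₀ + 1)] := by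
  have h2 : u - 2 ≠ 0 := by omega
  rw [Nat.modEq_two_iff_dvd_sub (by omega), Nat.modEq_two_iff_dvd_sub (by omega),
    hp.pow_dvd_iff_le_factorization h2, hp.pow_dvd_iff_le_factorization h2]
  by_cases h : ℓ ∣ u
  · have h0 := Nat.factorization_eq_zero_of_not_dvd
      (hp.not_dvd_sub_two_of_dvd hℓ (by omega : 2 ≤ u) h)
    have h1 := (hp.dvd_iff_one_le_factorization (by omega : u ≠ 0)).1 h
    have h3 : u - 3 ≤ (u - 3) * u.factorization ℓ := Nat.le_mul_of_pos_right _ h1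
    omega
  · rw [Nat.factorization_eq_zero_of_not_dvd h]
    omega


/-- for an odd prime `ℓ` and `μ₀ ≥ 0`, the natural density of integers
`u ≥ 4` with `v_ℓ(u-2) + (u-3)·v_ℓ(u) = μ₀` — equivalently, the density of `u` for which
the `ℤ_ℓ`-towers of the complete graph `K_u` attached to the voltage assignments
`α(a,u)`, `α′(a,u)` have Iwasawa invariants `(μ, λ) = (μ₀, 1)` — equals `(ℓ-2)/ℓ` if
`μ₀ = 0` and `(ℓ-1)/ℓ^{μ₀+1}` if `μ₀ > 0`. -/
theorem density_complete_graph_mu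
    (ℓ : ℕ) (hp : ℓ.Prime) (hℓ : Odd ℓ) (μ₀ : ℕ) :
    (μ₀ = 0 →
      Filter.Tendsto
        (fun x : ℕ =>
          ((((Finset.Icc 4 x).filter fun u =>
            (u - 2).factorization ℓ + (u - 3) * u.factorization ℓ = μ₀).card : ℝ) / (x : ℝ)))
        Filter.atTop (nhds (((ℓ : ℝ) - 2) / (ℓ : ℝ)))) ∧
    (0 < μ₀ →
      Filter.Tendsto
        (fun x : ℕ =>
          ((((Finset.Icc 4 x).filter fun u =>
            (u - 2).factorization ℓ + (u - 3) * u.factorization ℓ = μ₀).card : ℝ) / (x : ℝ)))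
        Filter.atTop (nhds (((ℓ : ℝ) - 1) / (ℓ : ℝ) ^ (μ₀ + 1)))) := by

  have hℓ0 : (ℓ : ℝ) ≠ 0 := by exact_mod_cast hp.ne_zero
  constructor
  · rintro rfl
    refine tendsto_card_filter_Icc_div_of_iff _ _ 4 4 _
      (fun u hu => factorization_sub_two_add_eq_zero_iff hp hu) ?_
    have h1 : Filter.Tendsto (fun x : ℕ => (x : ℝ) / x) Filter.atTop (nhds 1) :=
      tendsto_const_nhds.congr' <| by
        filter_upwards [Filter.eventually_ne_atTop 0] with x hx
        rw [div_self (by exact_mod_cast hx)]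
    have hlim := (h1.sub (tendsto_card_filter_modEq_div ℓ 0 hp.pos)).sub
      (tendsto_card_filter_modEq_div ℓ 2 hp.pos)
    have hd : ((ℓ : ℝ) - 2) / ℓ = 1 - 1 / ℓ - 1 / ℓ := by
      field_simp
      ring
    rw [hd]
    refine hlim.congr fun x => ?_
    rw [← sub_div, ← sub_div]
    congr 1
    nth_rewrite 1 [← Finset.card_range x]
    simp only [Finset.card_eq_sum_ones, Finset.sum_filter, Nat.cast_sum, ← Finset.sum_sub_distrib]
    refine Finset.sum_congr rfl fun u _ => ?_
    have hdisj : u ≡ 0 [MOD ℓ] → ¬ u ≡ 2 [MOD ℓ] := fun h h' => by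
      have h2 := (Nat.modEq_zero_iff_dvd).1 (h'.symm.trans h)
      rw [(Nat.prime_dvd_prime_iff_eq hp Nat.prime_two).1 h2] at hℓ
      exact absurd hℓ (by decide)
    by_cases h0 : u ≡ 0 [MOD ℓ]
    · simp [h0, hdisj h0]
    · by_cases h2 : u ≡ 2 [MOD ℓ] <;> simp [h0, h2]
  · intro hμ
    refine tendsto_card_filter_Icc_div_of_iff _ _ 4 (μ₀ + 4) _
      (fun u hu => factorization_sub_two_add_eq_iff hp hℓ hμ hu) ?_
    have hlim := (tendsto_card_filter_modEq_div (ℓ ^ μ₀) 2 (pow_pos hp.pos _)).sub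
      (tendsto_card_filter_modEq_div (ℓ ^ (μ₀ + 1)) 2 (pow_pos hp.pos _))
    have hd : ((ℓ : ℝ) - 1) / ℓ ^ (μ₀ + 1) =
        1 / ((ℓ ^ μ₀ : ℕ) : ℝ) - 1 / ((ℓ ^ (μ₀ + 1) : ℕ) : ℝ) := by
      push_cast
      field_simp
      ring
    rw [hd]
    refine hlim.congr fun x => ?_
    rw [← sub_div]
    congr 1
    simp only [Finset.card_eq_sum_ones, Finset.sum_filter, Nat.cast_sum, ← Finset.sum_sub_distrib]
    refine Finset.sum_congr rfl fun u _ => ?_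
    have himp : u ≡ 2 [MOD ℓ ^ (μ₀ + 1)] → u ≡ 2 [MOD ℓ ^ μ₀] :=
      Nat.ModEq.of_dvd (pow_dvd_pow _ (Nat.le_succ _))
    by_cases h0 : u ≡ 2 [MOD ℓ ^ (μ₀ + 1)]
    · simp [h0, himp h0]
    · by_cases h2 : u ≡ 2 [MOD ℓ ^ μ₀] <;> simp [h0, h2]
end
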